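/- Let n ≥ 3 and let A, B ⊆ ℝⁿ be two bounded Lebesgue measurable sets with non-empty interiors and of the same Lebesgue measure. Then A and B are equidecomposable using pieces that are Lebesgue measurable; that is, there exist m ∈ ℕ, isometries γ₁,…,γ_m of ℝⁿ, and partitions A = A₁ ⊔ … ⊔ A_m and B = B₁ ⊔ … ⊔ B_m into Lebesgue measurable pieces such that γᵢ(Aᵢ) = Bᵢ for each i ∈ {1,…,m}. -/

import Mathlib

open MeasureTheory Set

noncomputable section

/-- `n`-dimensional Euclidean space `ℝⁿ`. -/
abbrev EucSp (n : ℕ) : Type := EuclideanSpace ℝ (Fin n)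

/-- `A` and `B` are equidecomposable with Lebesgue measurable pieces: there are `m ∈ ℕ`,
isometries `γ₁, …, γ_m` of `ℝⁿ` and partitions `A = A₁ ⊔ … ⊔ A_m`, `B = B₁ ⊔ … ⊔ B_m`
into Lebesgue measurable pieces with `γᵢ(Aᵢ) = Bᵢ` for every `i`. -/
def MeasurablyEquidecomposable (n : ℕ) (A B : Set (EucSp n)) : Prop :=
  ∃ (m : ℕ) (γ : Fin m → (EucSp n ≃ᵢ EucSp n)) (P : Fin m → Set (EucSp n)),
    (∀ i, NullMeasurableSet (P i) volume) ∧
    (∀ i j, i ≠ j → Disjoint (P i) (P j)) ∧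
    (⋃ i, P i) = A ∧
    (∀ i j, i ≠ j → Disjoint ((γ i) '' P i) ((γ j) '' P j)) ∧
    (⋃ i, (γ i) '' P i) = B

section Plancherel
open FourierTransform SchwartzMap
open scoped ENNReal

theorem eLpNorm_two_sq {α : Type*} [MeasurableSpace α] (f : α → ℂ) (μ : Measure α) :
    eLpNorm f 2 μ ^ 2 = ∫⁻ x, ‖f x‖ₑ ^ 2 ∂μ := by
  have := eLpNorm_nnreal_pow_eq_lintegral (f := f) (μ := μ) (p := 2) (by norm_num)
  simpa using this

variable {V : Type*} [NormedAddCommGroup V] [InnerProductSpace ℝ V] [FiniteDimensional ℝ V]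
  [MeasurableSpace V] [BorelSpace V]

theorem continuous_fourier {f : V → ℂ} (hf : Integrable f) : Continuous (𝓕 f) :=
  VectorFourier.fourierIntegral_continuous Real.continuous_fourierChar
    (by exact continuous_inner) hf

theorem coeFn_fourier_toLp {f : V → ℂ} (hf : Integrable f) (hf2 : MemLp f 2) :
    ((𝓕 (hf2.toLp f) : Lp ℂ 2 (volume : Measure V)) : V → ℂ) =ᵐ[volume] 𝓕 f := by
  apply ae_eq_of_integral_contDiff_smul_eq
  · exact (Lp.memLp _).locallyIntegrable (by norm_num)
  · exact (continuous_fourier hf).locallyIntegrable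
  intro g hg hgc
  have hgc' : HasCompactSupport (fun x => (g x : ℂ)) := hgc.comp_left (g := Complex.ofReal) rfl
  have hg' : ContDiff ℝ (⊤ : ℕ∞) (fun x => (g x : ℂ)) := Complex.ofRealCLM.contDiff.comp hg
  set φ : 𝓢(V, ℂ) := hgc'.toSchwartzMap hg' with hφ
  have h1 : ∫ x, φ x • (𝓕 (hf2.toLp f) : Lp ℂ 2 (volume : Measure V)) x
      = ∫ x, (𝓕 φ) x • (hf2.toLp f) x := by
    have := congrArg (fun T => T φ) (Lp.fourier_toTemperedDistribution_eq (hf2.toLp f))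
    simp only [TemperedDistribution.fourier_apply, Lp.toTemperedDistribution_apply] at this
    exact this.symm
  have h2 : ∫ x, (𝓕 φ) x • (hf2.toLp f) x = ∫ x, (𝓕 φ) x • f x := by
    apply integral_congr_ae
    filter_upwards [hf2.coeFn_toLp] with x hx
    rw [hx]
  have h3 : ∫ x, (𝓕 φ) x • f x = ∫ x, φ x • 𝓕 f x := by
    have := VectorFourier.integral_fourierIntegral_smul_eq_flip (L := innerₗ V)
      (μ := (volume : Measure V)) (ν := (volume : Measure V))
      Real.continuous_fourierChar (by exact continuous_inner) φ.integrable hf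
    rw [flip_innerₗ] at this
    exact this
  have h := h1.trans (h2.trans h3)
  simpa [hφ] using h

/-- Plancherel's theorem for functions in `L¹ ∩ L²`. -/
theorem eLpNorm_fourier_eq {f : V → ℂ} (hf : Integrable f) (hf2 : MemLp f 2) :
    eLpNorm (𝓕 f) 2 volume = eLpNorm f 2 volume := by
  rw [← eLpNorm_congr_ae (coeFn_fourier_toLp hf hf2)]
  have := Lp.norm_fourier_eq (hf2.toLp f)
  rw [Lp.norm_def, Lp.norm_toLp] at this
  exact (ENNReal.toReal_eq_toReal_iff' (Lp.memLp _).2.ne hf2.2.ne).1 this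

theorem integrable_indicator_one {Z : Set V} (hZ : MeasurableSet Z) (hf : volume Z ≠ ∞) :
    Integrable (Z.indicator (fun _ => (1 : ℂ))) :=
  (integrable_indicator_iff hZ).2 (integrableOn_const hf)

theorem memLp_indicator_one {Z : Set V} (hZ : MeasurableSet Z) (hf : volume Z ≠ ∞) :
    MemLp (Z.indicator (fun _ => (1 : ℂ))) 2 :=
  memLp_indicator_const 2 hZ 1 (Or.inr hf)

theorem eLpNorm_indicator_sub_sq {S Z : Set V} (hS : MeasurableSet S) (hZ : MeasurableSet Z) :
    eLpNorm (S.indicator (fun _ => (1 : ℂ)) - Z.indicator (fun _ => (1 : ℂ))) 2 volume ^ 2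
      = volume (symmDiff S Z) := by
  rw [eLpNorm_two_sq, ← lintegral_indicator_one (hS.symmDiff hZ)]
  congr 1 with x
  by_cases h1 : x ∈ S <;> by_cases h2 : x ∈ Z <;>
    simp [h1, h2, indicator, Set.mem_symmDiff]

/-- The spectral measure of a set: the measure whose density is the squared modulus of the Fourier
transform of its indicator function. -/
def specMeasure (Z : Set V) : Measure V :=
  volume.withDensity fun ξ => ‖𝓕 (Z.indicator (fun _ => (1 : ℂ))) ξ‖ₑ ^ 2

theorem specMeasure_univ {Z : Set V} (hZ : MeasurableSet Z) (hf : volume Z ≠ ∞) :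
    specMeasure Z univ = volume Z := by
  rw [specMeasure, withDensity_apply _ MeasurableSet.univ, Measure.restrict_univ, ← eLpNorm_two_sq,
    eLpNorm_fourier_eq (integrable_indicator_one hZ hf) (memLp_indicator_one hZ hf)]
  simpa [← Pi.zero_def, Set.symmDiff_def] using eLpNorm_indicator_sub_sq hZ MeasurableSet.empty

theorem fourier_sub' {f g : V → ℂ} (hf : Integrable f) (hg : Integrable g) :
    𝓕 (f - g) = 𝓕 f - 𝓕 g := by
  ext w
  simp only [Real.fourier_eq, Pi.sub_apply, smul_sub]
  exact integral_sub ((Real.fourierIntegral_convergent_iff w).2 hf)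
    ((Real.fourierIntegral_convergent_iff w).2 hg)

theorem fourier_comp_add (f : V → ℂ) (v w : V) :
    𝓕 (fun x => f (x + v)) w = Real.fourierChar (inner ℝ v w) • 𝓕 f w :=
  congrFun (VectorFourier.fourierIntegral_comp_add_right Real.fourierChar volume (innerₗ V) f v) w

theorem lintegral_fourierChar_sub_one {Z : Set V} (hZ : MeasurableSet Z) (hf : volume Z ≠ ∞)
    (v : V) :
    ∫⁻ ξ, ‖(Real.fourierChar (inner ℝ v ξ) : ℂ) - 1‖ₑ ^ 2 ∂(specMeasure Z)
      = volume (symmDiff ((· + v) ⁻¹' Z) Z) := by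
  have hv : Measurable fun x : V => x + v := measurable_add_const v
  have hZ' : MeasurableSet ((· + v) ⁻¹' Z) := hv hZ
  have hf' : volume ((· + v) ⁻¹' Z) ≠ ∞ := by rwa [measure_preimage_add_right]
  have e : 𝓕 (((· + v) ⁻¹' Z).indicator (fun _ => (1 : ℂ)))
      = fun w => Real.fourierChar (inner ℝ v w) • 𝓕 (Z.indicator (fun _ => (1 : ℂ))) w := by
    ext w; rw [← fourier_comp_add]; rfl
  have hc := continuous_fourier (integrable_indicator_one hZ hf)
  rw [← eLpNorm_indicator_sub_sq hZ' hZ, ← eLpNorm_fourier_eq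
    ((integrable_indicator_one hZ' hf').sub (integrable_indicator_one hZ hf))
    ((memLp_indicator_one hZ' hf').sub (memLp_indicator_one hZ hf)), fourier_sub'
    (integrable_indicator_one hZ' hf') (integrable_indicator_one hZ hf), e, eLpNorm_two_sq,
    specMeasure, lintegral_withDensity_eq_lintegral_mul]
  · congr 1 with ξ
    rw [Pi.mul_apply, ← mul_pow, ← enorm_mul, Pi.sub_apply, Circle.smul_def, smul_eq_mul]
    congr 2; ring
  · exact (hc.measurable.enorm).pow_const 2
  · have : Continuous fun ξ : V => (Real.fourierChar (inner ℝ v ξ) : ℂ) :=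
      continuous_subtype_val.comp (Real.continuous_fourierChar.comp (by fun_prop))
    exact ((this.sub continuous_const).measurable.enorm).pow_const 2

theorem specMeasure_eq_eLpNorm_sq (Z : Set V) {S : Set V} (hS : MeasurableSet S) :
    specMeasure Z S
      = eLpNorm (𝓕 (Z.indicator (fun _ => (1 : ℂ)))) 2 (volume.restrict S) ^ 2 := by
  rw [specMeasure, withDensity_apply _ hS, eLpNorm_two_sq]

theorem specMeasure_preimage_symm_le {Z : Set V} (hZ : MeasurableSet Z) (hf : volume Z ≠ ∞)
    (g : V ≃ₗᵢ[ℝ] V) {S : Set V} (hS : MeasurableSet S) {ε : ℝ} (h0 : 0 ≤ ε) (h1 : ε ≤ 1)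
    (h : volume (symmDiff (g ⁻¹' Z) Z) ≤ ENNReal.ofReal (ε ^ 2) * volume Z) :
    (specMeasure Z).real (g.symm ⁻¹' S) ≤ (specMeasure Z).real S + 3 * ε * volume.real Z := by
  set u := Z.indicator (fun _ => (1 : ℂ)) with hu
  have hgm : Measurable g := g.continuous.measurable
  have hZ' : MeasurableSet (g ⁻¹' Z) := hgm hZ
  have hf' : volume (g ⁻¹' Z) ≠ ∞ := by
    rwa [g.measurePreserving.measure_preimage hZ.nullMeasurableSet]
  have e : 𝓕 ((g ⁻¹' Z).indicator (fun _ => (1 : ℂ))) = fun w => 𝓕 u (g w) := by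
    ext w; rw [← Real.fourier_comp_linearIsometry]; rfl
  have e1 : eLpNorm (fun w => 𝓕 u (g w)) 2 (volume.restrict S) ^ 2
      = specMeasure Z (g.symm ⁻¹' S) := by
    have hS' : MeasurableSet (g.symm ⁻¹' S) := g.symm.continuous.measurable hS
    rw [eLpNorm_two_sq, specMeasure, withDensity_apply _ hS']
    have := g.measurePreserving.setLIntegral_comp_preimage hS'
      (f := fun w => ‖𝓕 u w‖ₑ ^ 2) ((continuous_fourier
        (integrable_indicator_one hZ hf)).measurable.enorm.pow_const 2)
    rw [← this]
    congr 2
    ext x; simp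
  have htri : eLpNorm (fun w => 𝓕 u (g w)) 2 (volume.restrict S)
      ≤ eLpNorm (𝓕 u) 2 (volume.restrict S) + eLpNorm (fun w => 𝓕 u (g w) - 𝓕 u w) 2 volume := by
    have hc := continuous_fourier (integrable_indicator_one hZ hf)
    calc eLpNorm (fun w => 𝓕 u (g w)) 2 (volume.restrict S)
        = eLpNorm (𝓕 u + fun w => 𝓕 u (g w) - 𝓕 u w) 2 (volume.restrict S) := by
          congr 1; ext w; simp
      _ ≤ eLpNorm (𝓕 u) 2 (volume.restrict S)
          + eLpNorm (fun w => 𝓕 u (g w) - 𝓕 u w) 2 (volume.restrict S) :=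
          eLpNorm_add_le hc.aestronglyMeasurable
            ((hc.comp g.continuous).sub hc).aestronglyMeasurable (by norm_num)
      _ ≤ _ := by gcongr; exact Measure.restrict_le_self
  have e2 : eLpNorm (fun w => 𝓕 u (g w) - 𝓕 u w) 2 volume ^ 2
      = volume (symmDiff (g ⁻¹' Z) Z) := by
    rw [← eLpNorm_indicator_sub_sq hZ' hZ, ← eLpNorm_fourier_eq
      ((integrable_indicator_one hZ' hf').sub (integrable_indicator_one hZ hf))
      ((memLp_indicator_one hZ' hf').sub (memLp_indicator_one hZ hf)), fourier_sub'
      (integrable_indicator_one hZ' hf') (integrable_indicator_one hZ hf), e]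
    rfl
  rw [← e2] at h
  have hfin : ∀ S, specMeasure Z S ≠ ∞ := fun S =>
    ne_top_of_le_ne_top (specMeasure_univ hZ hf ▸ hf) (measure_mono (subset_univ S))
  have hE := specMeasure_eq_eLpNorm_sq Z hS
  have hES : specMeasure Z S ≤ volume Z :=
    (specMeasure_univ hZ hf) ▸ measure_mono (subset_univ S)
  have hX := hfin (g.symm ⁻¹' S)
  have hY := hfin S
  rw [← hu] at hE
  rw [Measure.real, Measure.real, ← e1, hE]
  rw [← e1] at hX
  rw [hE] at hY hES
  generalize eLpNorm (fun w => 𝓕 u (g w)) 2 (volume.restrict S) = a at *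
  generalize eLpNorm (𝓕 u) 2 (volume.restrict S) = b at *
  generalize eLpNorm (fun w => 𝓕 u (g w) - 𝓕 u w) 2 volume = c at *
  have hc' : c ^ 2 ≠ ∞ := ne_top_of_le_ne_top (ENNReal.mul_ne_top ENNReal.ofReal_ne_top hf) h
  have ha : a ≠ ∞ := by rintro rfl; simp at hX
  have hb : b ≠ ∞ := by rintro rfl; simp at hY
  have hc : c ≠ ∞ := by rintro rfl; simp at hc'
  have t1 := ENNReal.toReal_mono (ENNReal.add_ne_top.2 ⟨hb, hc⟩) htri
  have t2 := ENNReal.toReal_mono (ENNReal.mul_ne_top ENNReal.ofReal_ne_top hf) h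
  have t3 := ENNReal.toReal_mono hf hES
  rw [ENNReal.toReal_add hb hc] at t1
  rw [ENNReal.toReal_mul, ENNReal.toReal_ofReal (by positivity), ENNReal.toReal_pow] at t2
  rw [ENNReal.toReal_pow] at t3 ⊢
  rw [ENNReal.toReal_pow]
  change c.toReal ^ 2 ≤ ε ^ 2 * volume.real Z at t2
  change b.toReal ^ 2 ≤ volume.real Z at t3
  have ha0 : 0 ≤ a.toReal := ENNReal.toReal_nonneg
  have hb0 : 0 ≤ b.toReal := ENNReal.toReal_nonneg
  have hc0 : 0 ≤ c.toReal := ENNReal.toReal_nonneg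
  have hM : 0 ≤ volume.real Z := measureReal_nonneg
  have hbc : b.toReal * c.toReal ≤ ε * volume.real Z := by
    apply abs_le_of_sq_le_sq' _ (by positivity) |>.2
    nlinarith [mul_le_mul t3 t2 (by positivity) hM]
  nlinarith [mul_le_mul_of_nonneg_right (mul_le_mul_of_nonneg_left h1 h0) hM]
end Plancherel

section Rotations

/-- The linear map acting on the coordinates `i`, `j` as the rotation with cosine `3/5` and
sine `4/5`, and fixing all other coordinates. -/
def rotFun {K ι : Type*} [Field K] [DecidableEq ι] (i j : ι) (x : ι → K) : ι → K := fun k =>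
  if k = i then (3 * x i - 4 * x j) / 5 else if k = j then (4 * x i + 3 * x j) / 5 else x k

theorem rotFun_rotFun {K ι : Type*} [Field K] [CharZero K] [DecidableEq ι] {i j : ι} (h : i ≠ j)
    (x : ι → K) : rotFun j i (rotFun i j x) = x := by
  ext k
  simp only [rotFun, if_neg h.symm, if_true]
  split_ifs <;> (try subst_vars) <;> first | field_simp; ring | rfl

theorem rotFun_comp {K ι κ : Type*} [Field K] [DecidableEq ι] [DecidableEq κ] (t : κ ↪ ι)
    (i j : κ) (x : ι → K) : rotFun (t i) (t j) x ∘ t = rotFun i j (x ∘ t) := by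
  ext k
  simp [rotFun, t.injective.eq_iff]

theorem rotFun_smul {K ι : Type*} [Field K] [DecidableEq ι] (i j : ι) (c : K) (x : ι → K) :
    rotFun i j (c • x) = c • rotFun i j x := by
  ext k
  simp only [rotFun, Pi.smul_apply, smul_eq_mul]
  split_ifs <;> ring

theorem rotFun_zero {K ι : Type*} [Field K] [DecidableEq ι] (i j : ι) :
    rotFun i j (0 : ι → K) = 0 := by
  simpa using rotFun_smul i j (0 : K) 0

theorem rotFun_ne_zero {K ι : Type*} [Field K] [CharZero K] [DecidableEq ι] {i j : ι} (h : i ≠ j)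
    {x : ι → K} (hx : x ≠ 0) : rotFun i j x ≠ 0 := fun h0 =>
  hx (by rw [← rotFun_rotFun h x, h0, rotFun_zero])

theorem sum_sq_rotFun {ι : Type*} [Fintype ι] [DecidableEq ι] {i j : ι} (h : i ≠ j) (x : ι → ℝ) :
    ∑ k, rotFun i j x k ^ 2 = ∑ k, x k ^ 2 := by
  rw [← sub_eq_zero, ← Finset.sum_sub_distrib,
    ← Finset.sum_subset (Finset.subset_univ {i, j}), Finset.sum_pair h]
  · simp only [rotFun, if_true, if_neg h.symm]
    ring
  · intro k _ hk
    simp only [Finset.mem_insert, Finset.mem_singleton, not_or] at hk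
    simp [rotFun, hk.1, hk.2]

/-- The rotation `rotFun i j` as a linear isometry of Euclidean space. -/
def rot {n : ℕ} {i j : Fin n} (h : i ≠ j) : EucSp n ≃ₗᵢ[ℝ] EucSp n where
  toFun x := WithLp.toLp 2 (rotFun i j x)
  invFun x := WithLp.toLp 2 (rotFun j i x)
  map_add' x y := by
    ext k
    simp only [rotFun, PiLp.add_apply]
    split_ifs <;> ring
  map_smul' c x := by
    ext k
    simp only [rotFun, PiLp.smul_apply, smul_eq_mul, RingHom.id_apply]
    split_ifs <;> ring
  left_inv x := by ext k; simp [rotFun_rotFun h]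
  right_inv x := by ext k; simp [rotFun_rotFun h.symm]
  norm_map' x := by
    simp only [LinearEquiv.coe_mk, LinearMap.coe_mk, AddHom.coe_mk]
    rw [← sq_eq_sq₀ (norm_nonneg _) (norm_nonneg _), EuclideanSpace.norm_sq_eq,
      EuclideanSpace.norm_sq_eq]
    simpa using sum_sq_rotFun h x

instance : Fact (Nat.Prime 5) := ⟨by norm_num⟩

theorem card_zmod_kernel_le : ∀ z : Fin 3 → ZMod 5, z ≠ 0 →
    ((Finset.univ : Finset (Fin 3)).offDiag.filter
      fun p => 3 * z p.1 - 4 * z p.2 = 0).card ≤ 2 := by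
  decide +kernel

/-- At most two of the six coordinate rotations fail to expand a given vector `5`-adically. -/
theorem card_nonexpanding_le {q : Fin 3 → ℚ_[5]} (hq : q ≠ 0) :
    ((Finset.univ : Finset (Fin 3)).offDiag.filter
      fun p => ‖rotFun p.1 p.2 q‖ ≤ ‖q‖).card ≤ 2 := by
  obtain ⟨k, -, hk⟩ := Finset.exists_max_image Finset.univ (fun k => ‖q k‖)
    Finset.univ_nonempty
  have hk' : ‖q‖ = ‖q k‖ := le_antisymm
    ((pi_norm_le_iff_of_nonneg (norm_nonneg _)).2 fun i => hk i (Finset.mem_univ i))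
    (norm_le_pi_norm q k)
  have hqk : 0 < ‖q k‖ := hk' ▸ norm_pos_iff.2 hq
  have hqk0 : q k ≠ 0 := norm_pos_iff.1 hqk
  have hr : ∀ i, ‖q i / q k‖ ≤ 1 := fun i => by
    rw [norm_div]; exact div_le_one_of_le₀ (hk i (Finset.mem_univ i)) hqk.le
  let r : Fin 3 → ℤ_[5] := fun i => ⟨q i / q k, hr i⟩
  let z : Fin 3 → ZMod 5 := fun i => PadicInt.toZMod (r i)
  have hz : z ≠ 0 := by
    intro h
    have h1 : z k = 1 := by
      have : r k = 1 := Subtype.ext (div_self hqk0)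
      simp [z, this]
    rw [h] at h1
    exact zero_ne_one h1
  refine (Finset.card_le_card ?_).trans (card_zmod_kernel_le z hz)
  intro p hp
  rw [Finset.mem_filter] at hp ⊢
  refine ⟨hp.1, ?_⟩
  have h1 : ‖rotFun p.1 p.2 q p.1‖ ≤ ‖q k‖ := (norm_le_pi_norm _ _).trans (hk' ▸ hp.2)
  have h2 : 3 * z p.1 - 4 * z p.2 = PadicInt.toZMod (3 * r p.1 - 4 * r p.2) := by
    simp only [map_sub, map_mul, z, map_ofNat]
  rw [h2, ← RingHom.mem_ker, PadicInt.ker_toZMod, IsLocalRing.mem_maximalIdeal,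
    PadicInt.mem_nonunits]
  have h3 : rotFun p.1 p.2 q p.1 = (3 * r p.1 - 4 * r p.2 : ℤ_[5]) / 5 * q k := by
    simp only [rotFun, if_true]
    have er : ∀ i, (r i : ℚ_[5]) = q i / q k := fun _ => rfl
    rw [PadicInt.coe_sub, PadicInt.coe_mul, PadicInt.coe_mul, er, er]
    have e3 : ((3 : ℤ_[5]) : ℚ_[5]) = 3 := rfl
    have e4 : ((4 : ℤ_[5]) : ℚ_[5]) = 4 := rfl
    rw [e3, e4]
    field_simp
  have h5 : ‖(5 : ℚ_[5])‖ = 5⁻¹ := by simpa using Padic.norm_p (p := 5)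
  rw [h3, norm_mul, norm_div, h5] at h1
  have h4 := le_of_mul_le_mul_right (h1.trans_eq (one_mul _).symm) hqk
  rw [PadicInt.norm_def]
  rw [div_inv_eq_mul] at h4
  linarith

end Rotations

section Equidecomposition

open scoped Pointwise

section IsometryAction

instance isometryEquivMulAction {X : Type*} [PseudoEMetricSpace X] : MulAction (X ≃ᵢ X) X where
  smul g x := g x
  one_smul _ := rfl
  mul_smul _ _ _ := rfl

theorem isometryEquiv_smul_def {X : Type*} [PseudoEMetricSpace X] (g : X ≃ᵢ X) (x : X) :
    g • x = g x := rfl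

instance {X : Type*} [PseudoEMetricSpace X] : IsIsometricSMul (X ≃ᵢ X) X where
  isometry_smul g := g.isometry

instance {n : ℕ} : SMulInvariantMeasure (EucSp n ≃ᵢ EucSp n) (EucSp n) volume where
  measure_preimage_smul g s hs := by
    have h : MeasurePreserving (fun x => g • x) (volume : Measure (EucSp n)) volume := by
      have h1 := (g.toRealAffineIsometryEquiv.linearIsometryEquiv).measurePreserving
      have h2 := (measurePreserving_add_right (volume : Measure (EucSp n)) (g 0)).comp h1
      have e : (fun x => g • x) =
          (fun x => x + g 0) ∘ g.toRealAffineIsometryEquiv.linearIsometryEquiv := by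
        funext x
        simpa [isometryEquiv_smul_def] using g.toRealAffineIsometryEquiv.map_vadd 0 x
      rw [e]
      exact h2
    exact h.measure_preimage hs.nullMeasurableSet

/-- Translation by `v` as an isometry. -/
def transl {n : ℕ} (v : EucSp n) : EucSp n ≃ᵢ EucSp n := IsometryEquiv.addRight v

theorem transl_smul {n : ℕ} (v x : EucSp n) : transl v • x = x + v := rfl

theorem norm_smul_of_map_zero {n : ℕ} {g : EucSp n ≃ᵢ EucSp n} (hg : g • (0 : EucSp n) = 0)
    (x : EucSp n) : ‖g • x‖ = ‖x‖ := by
  rw [← dist_zero_right, ← dist_zero_right]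
  nth_rewrite 1 [← hg]
  exact dist_smul g x 0

/-- The rotation in the coordinate plane indexed by two values of an embedding. -/
def tripleRot {n : ℕ} (t : Fin 3 ↪ Fin n) (p : Fin 3 × Fin 3) : EucSp n ≃ᵢ EucSp n :=
  if h : p.1 ≠ p.2 then (rot (t.injective.ne h)).toIsometryEquiv else 1

theorem tripleRot_comp {n : ℕ} (t : Fin 3 ↪ Fin n) {p : Fin 3 × Fin 3} (h : p.1 ≠ p.2)
    (x : EucSp n) : (fun k => (tripleRot t p • x) (t k)) = rotFun p.1 p.2 fun k => x (t k) := by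
  rw [tripleRot, dif_pos h]
  exact rotFun_comp t p.1 p.2 x

theorem tripleRot_zero {n : ℕ} (t : Fin 3 ↪ Fin n) (p : Fin 3 × Fin 3) :
    tripleRot t p • (0 : EucSp n) = 0 := by
  rw [tripleRot]
  split_ifs with h
  · exact map_zero (rot (t.injective.ne h))
  · rfl

theorem tripleRot_comp_ne_zero {n : ℕ} (t : Fin 3 ↪ Fin n) (p : Fin 3 × Fin 3) {x : EucSp n}
    (hx : (fun k => x (t k)) ≠ 0) : (fun k => (tripleRot t p • x) (t k)) ≠ 0 := by
  by_cases h : p.1 = p.2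
  · rw [tripleRot, dif_neg (not_not.2 h)]
    exact hx
  · rw [tripleRot_comp t h]
    exact rotFun_ne_zero h hx

end IsometryAction

section Discrete

open Classical in
/-- Some coordinate rotation moves a third of any finite set outside of it. -/
theorem exists_card_le_card_smul_sdiff {n : ℕ} (t : Fin 3 ↪ Fin n) (X : Finset (EucSp n))
    (hX : ∀ x ∈ X, (fun k => x (t k)) ≠ 0) :
    ∃ p : Fin 3 × Fin 3, X.card ≤ 3 * ((tripleRot t p • X) \ X).card := by
  obtain ⟨f, hf⟩ : ∃ f : ℝ →ₗ[ℚ] ℚ, ∀ x ∈ X, (fun k => f (x (t k))) ≠ 0 := by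
    have h1 : ∀ x : X, ∃ k, (x : EucSp n) (t k) ≠ 0 := fun x => Function.ne_iff.1 (hX x x.2)
    choose k hk using h1
    obtain ⟨f, hf⟩ := Module.exists_dual_forall_apply_ne_zero (K := ℚ)
      (fun x : X => (x : EucSp n) (t (k x))) hk
    exact ⟨f, fun x hx => Function.ne_iff.2 ⟨k ⟨x, hx⟩, hf ⟨x, hx⟩⟩⟩
  let q : EucSp n → Fin 3 → ℚ_[5] := fun x k => (f (x (t k)) : ℚ_[5])
  have hq : ∀ x ∈ X, q x ≠ 0 := fun x hx h0 => hf x hx <| by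
    ext k
    have := congrFun h0 k
    simpa [q] using this
  have hf1 : ∀ (a : ℚ) (y : ℝ), f (a * y) = a * f y := fun a y => by
    rw [← Rat.smul_def, map_smul, smul_eq_mul]
  have hqr : ∀ p : Fin 3 × Fin 3, p.1 ≠ p.2 → ∀ x,
      q (tripleRot t p • x) = rotFun p.1 p.2 (q x) := by
    intro p hp x
    ext k
    have e1 := congrFun (tripleRot_comp t hp x) k
    simp only [q]
    rw [show (tripleRot t p • x) (t k) = _ from e1]
    have ha : ∀ a b : ℝ, f ((3 * a - 4 * b) / 5) = (3 * f a - 4 * f b) / 5 := fun a b => by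
      have := hf1 (3 / 5) a
      have h' := hf1 (4 / 5) b
      rw [show (3 * a - 4 * b) / 5 = ((3 / 5 : ℚ) : ℝ) * a - ((4 / 5 : ℚ) : ℝ) * b by
        push_cast; ring, map_sub, this, h']
      ring
    have hb : ∀ a b : ℝ, f ((4 * a + 3 * b) / 5) = (4 * f a + 3 * f b) / 5 := fun a b => by
      have := hf1 (4 / 5) a
      have h' := hf1 (3 / 5) b
      rw [show (4 * a + 3 * b) / 5 = ((4 / 5 : ℚ) : ℝ) * a + ((3 / 5 : ℚ) : ℝ) * b by
        push_cast; ring, map_add, this, h']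
      ring
    simp only [rotFun]
    split_ifs
    · rw [ha]; push_cast; rfl
    · rw [hb]; push_cast; rfl
    · rfl
  let K : Fin 3 × Fin 3 → Finset (EucSp n) := fun p =>
    X.filter fun x => ‖rotFun p.1 p.2 (q x)‖ ≤ ‖q x‖
  have hK : ∑ p ∈ (Finset.univ : Finset (Fin 3)).offDiag, (K p).card ≤ 2 * X.card := by
    simp only [K, Finset.card_filter]
    rw [Finset.sum_comm, mul_comm, ← smul_eq_mul]
    refine Finset.sum_le_card_nsmul _ _ _ fun x hx => ?_
    rw [← Finset.card_filter]
    exact card_nonexpanding_le (hq x hx)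
  have hK2 : ∑ p ∈ (Finset.univ : Finset (Fin 3)).offDiag, (K p.swap).card ≤ 2 * X.card := by
    refine le_trans (le_of_eq ?_) hK
    refine Finset.sum_equiv (Equiv.prodComm _ _) (fun p => ?_) fun p _ => rfl
    simp [ne_comm]
  have hstep : ∀ p ∈ (Finset.univ : Finset (Fin 3)).offDiag,
      X.card ≤ (K p).card + (K p.swap).card + ((tripleRot t p • X) \ X).card := by
    intro p hp
    have hp' : p.1 ≠ p.2 := by simpa using hp
    have hsub : tripleRot t p • (X \ K p) ⊆ K p.swap ∪ ((tripleRot t p • X) \ X) := by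
      intro y hy
      obtain ⟨x, hx, rfl⟩ := Finset.mem_smul_finset.1 hy
      rw [Finset.mem_sdiff] at hx
      by_cases hgx : tripleRot t p • x ∈ X
      · refine Finset.mem_union_left _ (Finset.mem_filter.2 ⟨hgx, ?_⟩)
        rw [hqr p hp' x, Prod.fst_swap, Prod.snd_swap, rotFun_rotFun hp']
        have : ¬ ‖rotFun p.1 p.2 (q x)‖ ≤ ‖q x‖ := fun h =>
          hx.2 (Finset.mem_filter.2 ⟨hx.1, h⟩)
        exact (not_le.1 this).le
      · exact Finset.mem_union_right _ (Finset.mem_sdiff.2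
          ⟨Finset.smul_mem_smul_finset hx.1, hgx⟩)
    have h1 := (Finset.card_le_card hsub).trans (Finset.card_union_le _ _)
    rw [Finset.card_smul_finset] at h1
    have h2 : (X \ K p).card + (K p).card = X.card :=
      Finset.card_sdiff_add_card_eq_card (Finset.filter_subset _ X : K p ⊆ X)
    omega
  by_contra! hcon
  have h1 := Finset.sum_le_sum hstep
  simp only [Finset.sum_add_distrib, Finset.sum_const, smul_eq_mul] at h1
  have h6 : (Finset.univ : Finset (Fin 3)).offDiag.card = 6 := by decide
  have h2 : ∑ p ∈ (Finset.univ : Finset (Fin 3)).offDiag,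
      (3 * ((tripleRot t p • X) \ X).card + 1) ≤ 6 * X.card := by
    rw [← h6, ← smul_eq_mul]
    exact Finset.sum_le_card_nsmul _ _ _ fun p _ => hcon p
  rw [Finset.sum_add_distrib, ← Finset.mul_sum, Finset.sum_const, h6, smul_eq_mul] at h2
  rw [h6] at h1
  omega

open Classical in
/-- Finitely many words in the coordinate rotations expand all finite sets by any prescribed
factor. -/
theorem exists_finset_pow_mul_card_le {n : ℕ} (t : Fin 3 ↪ Fin n) (k : ℕ) :
    ∃ S : Finset (EucSp n ≃ᵢ EucSp n), (∀ g ∈ S, g • (0 : EucSp n) = 0) ∧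
      ∀ X : Finset (EucSp n), (∀ x ∈ X, (fun k => x (t k)) ≠ 0) →
        4 ^ k * X.card ≤ 3 ^ k * (S • X).card := by
  suffices h : ∃ S : Finset (EucSp n ≃ᵢ EucSp n), (∀ g ∈ S, g • (0 : EucSp n) = 0) ∧
      (∀ g ∈ S, ∀ x : EucSp n, (fun k => x (t k)) ≠ 0 → (fun k => (g • x) (t k)) ≠ 0) ∧
      ∀ X : Finset (EucSp n), (∀ x ∈ X, (fun k => x (t k)) ≠ 0) →
        4 ^ k * X.card ≤ 3 ^ k * (S • X).card by
    obtain ⟨S, h1, -, h2⟩ := h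
    exact ⟨S, h1, h2⟩
  induction k with
  | zero => exact ⟨{1}, by simp, by simp, fun X _ => by simp⟩
  | succ k ih =>
    obtain ⟨S, h0, hne, hS⟩ := ih
    let R : Finset (EucSp n ≃ᵢ EucSp n) := insert 1 (Finset.univ.image (tripleRot t))
    have hR : ∀ g ∈ R, g = 1 ∨ ∃ p, tripleRot t p = g := by simp [R]
    have hR1 : 1 ∈ R := Finset.mem_insert_self _ _
    have hRp : ∀ p, tripleRot t p ∈ R := fun p =>
      Finset.mem_insert_of_mem (Finset.mem_image_of_mem _ (Finset.mem_univ p))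
    clear_value R
    refine ⟨R * S, fun g hg => ?_, fun g hg x hx => ?_, fun X hX => ?_⟩
    · obtain ⟨a, ha, b, hb, rfl⟩ := Finset.mem_mul.1 hg
      rw [mul_smul, h0 b hb]
      obtain rfl | ⟨p, rfl⟩ := hR a ha
      · exact one_smul _ _
      · exact tripleRot_zero t p
    · obtain ⟨a, ha, b, hb, rfl⟩ := Finset.mem_mul.1 hg
      rw [mul_smul]
      obtain rfl | ⟨p, rfl⟩ := hR a ha
      · rw [one_smul]
        exact hne b hb x hx
      · exact tripleRot_comp_ne_zero t p (hne b hb x hx)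
    · have hY : ∀ y ∈ S • X, (fun k => y (t k)) ≠ 0 := by
        intro y hy
        obtain ⟨a, ha, b, hb, rfl⟩ := Finset.mem_smul.1 hy
        exact hne a ha b (hX b hb)
      obtain ⟨p, hp⟩ := exists_card_le_card_smul_sdiff t (S • X) hY
      have hsub : (S • X) ∪ ((tripleRot t p • (S • X)) \ (S • X)) ⊆ (R * S) • X := by
        rw [mul_smul]
        intro y hy
        rcases Finset.mem_union.1 hy with h | h
        · rw [← one_smul (EucSp n ≃ᵢ EucSp n) y]
          exact Finset.smul_mem_smul hR1 h
        · obtain ⟨x, hx, rfl⟩ := Finset.mem_smul_finset.1 (Finset.mem_sdiff.1 h).1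
          exact Finset.smul_mem_smul (hRp p) hx
      have h1 := Finset.card_le_card hsub
      rw [Finset.card_union_of_disjoint Finset.disjoint_sdiff] at h1
      have h2 := hS X hX
      calc 4 ^ (k + 1) * X.card = 4 * (4 ^ k * X.card) := by ring
        _ ≤ 4 * (3 ^ k * (S • X).card) := by gcongr
        _ = 3 ^ k * (4 * (S • X).card) := by ring
        _ ≤ 3 ^ k * (3 * ((R * S) • X).card) :=
          Nat.mul_le_mul_left _ (by omega)
        _ = _ := by ring

end Discrete

section BanachTarski

open Classical in
/-- Every finite subset of a bounded set can be mapped, by finitely many isometries depending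
only on the sets, onto at least as many points of a given set with interior. -/
theorem exists_finset_card_le {n : ℕ} (hn : 3 ≤ n) {A B : Set (EucSp n)}
    (hA : Bornology.IsBounded A) (hB : (interior B).Nonempty) :
    ∃ S : Finset (EucSp n ≃ᵢ EucSp n), ∀ X : Finset (EucSp n), (∀ x ∈ X, x ∈ A) →
      X.card ≤ ((S • X).filter (· ∈ B)).card := by
  obtain ⟨z, hz⟩ := hB
  obtain ⟨r, hr, hzr⟩ := Metric.isOpen_iff.1 isOpen_interior z hz
  let t : Fin 3 ↪ Fin n := Fin.castLEEmb hn
  obtain ⟨F, hF, hAF⟩ := Metric.totallyBounded_iff.1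
    (hA.isCompact_closure.totallyBounded.subset subset_closure) (r / 2) (by positivity)
  lift F to Finset (EucSp n) using hF
  let e : EucSp n := EuclideanSpace.single (t 0) (r / 2)
  have he : ‖e‖ ≤ r / 2 := by simp [e, abs_of_pos hr]
  have het : e (t 0) = r / 2 := by simp [e]
  obtain ⟨k, hk⟩ : ∃ k : ℕ, 2 * (F.card : ℝ) < (4 / 3) ^ k :=
    pow_unbounded_of_one_lt _ (by norm_num)
  obtain ⟨S, hS0, hS⟩ := exists_finset_pow_mul_card_le t k
  refine ⟨({transl z} : Finset (EucSp n ≃ᵢ EucSp n)) * (S * (({1, transl e} : Finset _) *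
    F.image fun y => transl (-y))), fun X hX => ?_⟩
  rcases X.eq_empty_or_nonempty with rfl | hXne
  · simp
  have hcov : X.card ≤ ∑ y ∈ F, (X.filter (· ∈ Metric.ball y (r / 2))).card := by
    refine (Finset.card_le_card fun x hx => ?_).trans Finset.card_biUnion_le
    obtain ⟨y, hy, hxy⟩ := mem_iUnion₂.1 (hAF (hX x hx))
    exact Finset.mem_biUnion.2 ⟨y, by simpa using hy, Finset.mem_filter.2 ⟨hx, hxy⟩⟩
  have hFne : F.Nonempty := by
    by_contra h
    rw [Finset.not_nonempty_iff_eq_empty.1 h, Finset.sum_empty] at hcov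
    exact hXne.card_pos.ne' (Nat.le_zero.1 hcov)
  obtain ⟨y, hy, hmax⟩ := Finset.exists_max_image F
    (fun y => (X.filter (· ∈ Metric.ball y (r / 2))).card) hFne
  set X₁ := transl (-y) • X.filter (· ∈ Metric.ball y (r / 2)) with hX₁
  have hc1 : X.card ≤ F.card * X₁.card := by
    rw [Finset.card_smul_finset, ← smul_eq_mul]
    exact hcov.trans (Finset.sum_le_card_nsmul _ _ _ hmax)
  have hX₁r : ∀ x ∈ X₁, ‖x‖ < r / 2 := fun x hx => by
    obtain ⟨w, hw, rfl⟩ := Finset.mem_smul_finset.1 hx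
    rw [transl_smul, ← sub_eq_add_neg, ← dist_eq_norm]
    exact (Finset.mem_filter.1 hw).2
  obtain ⟨X₂, g, hg, hX₂, hc2, hX₂r, hX₂t⟩ : ∃ (X₂ : Finset (EucSp n)),
      ∃ g ∈ ({1, transl e} : Finset (EucSp n ≃ᵢ EucSp n)),
      X₂ ⊆ g • X₁ ∧ X₁.card ≤ 2 * X₂.card ∧ (∀ x ∈ X₂, ‖x‖ < r) ∧
        ∀ x ∈ X₂, (fun k => x (t k)) ≠ 0 := by
    have hsum := Finset.card_filter_add_card_filter_not (s := X₁) fun x => (fun k => x (t k)) ≠ 0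
    rcases le_total (X₁.filter fun x => ¬ (fun k => x (t k)) ≠ 0).card
      (X₁.filter fun x => (fun k => x (t k)) ≠ 0).card with h | h
    · refine ⟨_, 1, by simp, ?_, (by omega : X₁.card ≤
        2 * (X₁.filter fun x => (fun k => x (t k)) ≠ 0).card), fun x hx => ?_,
        fun x hx => (Finset.mem_filter.1 hx).2⟩
      · rw [one_smul]
        exact Finset.filter_subset _ _
      · linarith [hX₁r x (Finset.mem_filter.1 hx).1]
    · refine ⟨transl e • (X₁.filter fun x => ¬ (fun k => x (t k)) ≠ 0), transl e, by simp,
        Finset.smul_finset_subset_smul_finset (Finset.filter_subset _ _), ?_, fun x hx => ?_,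
        fun x hx => ?_⟩
      · have h' := Finset.card_smul_finset (transl e)
          (X₁.filter fun x => ¬ (fun k => x (t k)) ≠ 0)
        omega
      · obtain ⟨w, hw, rfl⟩ := Finset.mem_smul_finset.1 hx
        rw [transl_smul]
        linarith [norm_add_le w e, hX₁r w (Finset.mem_filter.1 hw).1]
      · obtain ⟨w, hw, rfl⟩ := Finset.mem_smul_finset.1 hx
        have hw0 : w (t 0) = 0 := congrFun (not_not.1 (Finset.mem_filter.1 hw).2) 0
        intro h0
        have h1 : w (t 0) + e (t 0) = 0 := congrFun h0 0
        rw [hw0, het] at h1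
        linarith
  have hc3 := hS X₂ hX₂t
  have hsub : transl z • (S • X₂) ⊆ ((({transl z} : Finset (EucSp n ≃ᵢ EucSp n)) * (S *
      (({1, transl e} : Finset _) * F.image fun y => transl (-y)))) • X).filter (· ∈ B) := by
    intro x hx
    obtain ⟨w, hw, rfl⟩ := Finset.mem_smul_finset.1 hx
    obtain ⟨s, hs, v, hv, rfl⟩ := Finset.mem_smul.1 hw
    refine Finset.mem_filter.2 ⟨?_, ?_⟩
    · obtain ⟨u, hu, rfl⟩ := Finset.mem_smul_finset.1 (hX₂ hv)
      obtain ⟨p, hp, rfl⟩ := Finset.mem_smul_finset.1 (hX₁ ▸ hu)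
      rw [smul_smul, smul_smul, smul_smul]
      refine Finset.smul_mem_smul ?_ (Finset.mem_filter.1 hp).1
      rw [mul_assoc, mul_assoc]
      exact Finset.mul_mem_mul (Finset.mem_singleton_self _) (Finset.mul_mem_mul hs
        (Finset.mul_mem_mul hg (Finset.mem_image_of_mem _ hy)))
    · refine interior_subset (hzr ?_)
      rw [transl_smul, Metric.mem_ball, dist_eq_norm, add_sub_cancel_right,
        norm_smul_of_map_zero (hS0 s hs)]
      exact hX₂r v hv
  have hc4 := Finset.card_le_card hsub
  rw [Finset.card_smul_finset] at hc4
  refine le_trans ?_ hc4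
  have h1 : (4 / 3 : ℝ) ^ k * X₂.card ≤ (S • X₂).card := by
    rw [div_pow, div_mul_eq_mul_div, div_le_iff₀ (by positivity), mul_comm ((S • X₂).card : ℝ)]
    exact_mod_cast hc3
  have h2 : (X.card : ℝ) ≤ F.card * X₁.card := by exact_mod_cast hc1
  have h3 : (X₁.card : ℝ) ≤ 2 * X₂.card := by exact_mod_cast hc2
  have h4 : (X.card : ℝ) ≤ (S • X₂).card := by
    calc (X.card : ℝ) ≤ F.card * (2 * X₂.card) := h2.trans (by gcongr)
      _ = 2 * F.card * X₂.card := by ring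
      _ ≤ (4 / 3 : ℝ) ^ k * X₂.card := by gcongr
      _ ≤ _ := h1
  exact_mod_cast h4

/-- An injection moving points along finitely many isometries. -/
theorem exists_finset_injective {n : ℕ} (hn : 3 ≤ n) {A B : Set (EucSp n)}
    (hA : Bornology.IsBounded A) (hB : (interior B).Nonempty) :
    ∃ (S : Finset (EucSp n ≃ᵢ EucSp n)) (f : A → B), Function.Injective f ∧
      ∀ a : A, ∃ s ∈ S, s • (a : EucSp n) = f a := by
  classical
  obtain ⟨S, hS⟩ := exists_finset_card_le hn hA hB
  obtain ⟨f, hf, hfS⟩ := (Finset.all_card_le_biUnion_card_iff_exists_injective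
    fun a : A => (S • ({(a : EucSp n)} : Finset (EucSp n))).filter (· ∈ B)).1 fun X => by
    have h := hS (X.map (Function.Embedding.subtype _)) fun x hx => by
      obtain ⟨a, -, rfl⟩ := Finset.mem_map.1 hx
      exact a.2
    rw [Finset.card_map] at h
    refine h.trans (Finset.card_le_card fun y hy => ?_)
    obtain ⟨hy1, hy2⟩ := Finset.mem_filter.1 hy
    obtain ⟨s, hs, x, hx, rfl⟩ := Finset.mem_smul.1 hy1
    obtain ⟨a, ha, rfl⟩ := Finset.mem_map.1 hx
    exact Finset.mem_biUnion.2 ⟨a, ha, Finset.mem_filter.2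
      ⟨Finset.smul_mem_smul hs (Finset.mem_singleton_self _), hy2⟩⟩
  refine ⟨S, fun a => ⟨f a, (Finset.mem_filter.1 (hfS a)).2⟩, fun a b h => hf ?_, fun a => ?_⟩
  · exact congrArg Subtype.val h
  · obtain ⟨s, hs, x, hx, h⟩ := Finset.mem_smul.1 (Finset.mem_filter.1 (hfS a)).1
    rw [Finset.mem_singleton.1 hx] at h
    exact ⟨s, hs, h⟩

/-- The Banach-Tarski theorem: bounded sets with interior are equidecomposable. -/
theorem exists_finset_bijective {n : ℕ} (hn : 3 ≤ n) {A B : Set (EucSp n)}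
    (hA : Bornology.IsBounded A) (hB : Bornology.IsBounded B)
    (hA' : (interior A).Nonempty) (hB' : (interior B).Nonempty) :
    ∃ (S : Finset (EucSp n ≃ᵢ EucSp n)) (h : A → B), Function.Bijective h ∧
      ∀ a : A, ∃ s ∈ S, s • (a : EucSp n) = h a := by
  classical
  obtain ⟨S, f, hf, hfS⟩ := exists_finset_injective hn hA hB'
  obtain ⟨T, g, hg, hgT⟩ := exists_finset_injective hn hB hA'
  obtain ⟨h, hh, hR⟩ := Function.Embedding.schroeder_bernstein_of_rel hf hg
    (fun a b => ∃ s ∈ S ∪ T⁻¹, s • (a : EucSp n) = b)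
    (fun a => by
      obtain ⟨s, hs, h⟩ := hfS a
      exact ⟨s, Finset.mem_union_left _ hs, h⟩)
    (fun b => by
      obtain ⟨s, hs, h⟩ := hgT b
      exact ⟨s⁻¹, Finset.mem_union_right _ (Finset.inv_mem_inv hs), by
        rw [← h, inv_smul_smul]⟩)
  exact ⟨_, h, hh, hR⟩

end BanachTarski

section PingPong

open Real in
theorem four_mul_abs_sub_round_le (x : ℝ) :
    4 * |x - round x| ≤ ‖(Real.fourierChar x : ℂ) - 1‖ := by
  have h1 : (Real.fourierChar x : ℂ) = Complex.exp (Complex.I * (2 * π * (x - round x) : ℝ)) := by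
    rw [Real.fourierChar_apply, ← (Complex.exp_periodic.int_mul (round x)) (Complex.I * _)]
    congr 1
    push_cast
    ring
  rw [h1, Complex.norm_exp_I_mul_ofReal_sub_one]
  have h2 := abs_sub_round x
  have h3 : |sin (2 * π * (x - round x) / 2)| = sin (π * |x - round x|) := by
    rw [show 2 * π * (x - round x) / 2 = π * (x - round x) by ring]
    have h0 : 0 ≤ sin (π * |x - round x|) :=
      sin_nonneg_of_nonneg_of_le_pi (by positivity) (by nlinarith [pi_pos])
    rcases abs_cases (x - round x) with ⟨h, -⟩ | ⟨h, -⟩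
    · rw [h] at h0 ⊢
      exact abs_of_nonneg h0
    · rw [h] at h0 ⊢
      rw [mul_neg, sin_neg] at h0 ⊢
      exact abs_of_nonpos (by linarith)
  rw [norm_mul, Real.norm_eq_abs (sin _), h3]
  have h4 := mul_le_sin (x := π * |x - round x|) (by positivity) (by nlinarith [pi_pos])
  have h5 : 2 / π * (π * |x - round x|) = 2 * |x - round x| := by field_simp
  rw [h5] at h4
  norm_num
  linarith

variable {n : ℕ}

/-- If a set is almost invariant under a translation, then its spectral measure is concentrated
near the dual lattice. -/
theorem specMeasure_far_le {Z : Set (EucSp n)} (hZ : MeasurableSet Z) (hf : volume Z ≠ ⊤)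
    {τ ε : ℝ} (i : Fin n)
    (h : volume (symmDiff ((· + EuclideanSpace.single i τ) ⁻¹' Z) Z)
      ≤ ENNReal.ofReal (ε ^ 2) * volume Z) :
    (specMeasure Z).real {ξ | 1 / 20 < |τ * ξ i - round (τ * ξ i)|}
      ≤ 25 * ε ^ 2 * volume.real Z := by
  have h1 := (lintegral_fourierChar_sub_one hZ hf (EuclideanSpace.single i τ)).trans_le h
  have hm : Measurable fun ξ : EucSp n =>
      ‖(Real.fourierChar (inner ℝ (EuclideanSpace.single i τ) ξ) : ℂ) - 1‖ₑ ^ 2 := by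
    refine Measurable.pow_const ?_ _
    refine Continuous.measurable ?_
    fun_prop
  have h2 := (mul_meas_ge_le_lintegral hm (μ := specMeasure Z) (ENNReal.ofReal (1 / 25))).trans h1
  have h3 : {ξ : EucSp n | 1 / 20 < |τ * ξ i - round (τ * ξ i)|} ⊆
      {ξ | ENNReal.ofReal (1 / 25) ≤
        ‖(Real.fourierChar (inner ℝ (EuclideanSpace.single i τ) ξ) : ℂ) - 1‖ₑ ^ 2} := by
    intro ξ hξ
    rw [mem_ofPred_eq] at hξ ⊢
    have e : inner ℝ (EuclideanSpace.single i τ) ξ = τ * ξ i := by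
      simp [EuclideanSpace.inner_single_left]
    rw [e, ← ofReal_norm, ← ENNReal.ofReal_pow (norm_nonneg _)]
    refine ENNReal.ofReal_le_ofReal ?_
    have := four_mul_abs_sub_round_le (τ * ξ i)
    nlinarith
  have h4 : ENNReal.ofReal (1 / 25) * specMeasure Z {ξ | 1 / 20 < |τ * ξ i - round (τ * ξ i)|}
      ≤ ENNReal.ofReal (ε ^ 2) * volume Z := le_trans (by gcongr) h2
  have h5 := ENNReal.toReal_mono (ENNReal.mul_ne_top ENNReal.ofReal_ne_top hf) h4
  rw [ENNReal.toReal_mul, ENNReal.toReal_mul, ENNReal.toReal_ofReal (by norm_num),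
    ENNReal.toReal_ofReal (sq_nonneg _)] at h5
  simp only [Measure.real] at h5 ⊢
  linarith

/-- Rounded coordinates of a frequency. -/
def roundTriple (t : Fin 3 ↪ Fin n) (τ : ℝ) (ξ : EucSp n) : Fin 3 → ℤ :=
  fun k => round (τ * ξ (t k))

theorem measurable_roundTriple (t : Fin 3 ↪ Fin n) (τ : ℝ) :
    Measurable (roundTriple t τ) := by
  refine measurable_pi_lambda _ fun k => ?_
  simp only [roundTriple, round_eq]
  refine Int.measurable_floor.comp ?_
  refine Continuous.measurable ?_
  fun_prop

theorem rotFun_roundTriple (t : Fin 3 ↪ Fin n) {τ : ℝ} {p : Fin 3 × Fin 3} (hp : p.1 ≠ p.2)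
    {ξ : EucSp n} (h : ∀ k, |τ * ξ (t k) - roundTriple t τ ξ k| ≤ 1 / 20)
    (h' : ∀ k, |τ * (tripleRot t p • ξ) (t k) - roundTriple t τ (tripleRot t p • ξ) k| ≤ 1 / 20) :
    (fun k => (roundTriple t τ (tripleRot t p • ξ) k : ℚ_[5]))
      = rotFun p.1 p.2 fun k => (roundTriple t τ ξ k : ℚ_[5]) := by
  have hr := tripleRot_comp t hp ξ
  set N := roundTriple t τ ξ with hN
  set N' := roundTriple t τ (tripleRot t p • ξ) with hN'
  have hzero : ∀ z : ℤ, |(z : ℝ)| < 1 → z = 0 := fun z hz => by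
    rw [← Int.abs_lt_one_iff]
    exact_mod_cast hz
  funext k
  have hk := congrFun hr k
  have hk' := abs_le.1 (h' k)
  have h1 := abs_le.1 (h p.1)
  have h2 := abs_le.1 (h p.2)
  have h3 := abs_le.1 (h k)
  simp only at hk
  rw [hk] at hk'
  simp only [rotFun] at hk' ⊢
  split_ifs at hk' ⊢
  · have : 5 * N' k - (3 * N p.1 - 4 * N p.2) = 0 := by
      refine hzero _ (abs_lt.2 ?_)
      push_cast
      constructor <;> linarith
    have e : (5 * (N' k : ℚ_[5])) = 3 * N p.1 - 4 * N p.2 := by exact_mod_cast sub_eq_zero.1 this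
    rw [eq_div_iff (by norm_num), mul_comm, e]
  · have : 5 * N' k - (4 * N p.1 + 3 * N p.2) = 0 := by
      refine hzero _ (abs_lt.2 ?_)
      push_cast
      constructor <;> linarith
    have e : (5 * (N' k : ℚ_[5])) = 4 * N p.1 + 3 * N p.2 := by exact_mod_cast sub_eq_zero.1 this
    rw [eq_div_iff (by norm_num), mul_comm, e]
  · have : N' k - N k = 0 := by
      refine hzero _ (abs_lt.2 ?_)
      push_cast
      constructor <;> linarith
    rw [sub_eq_zero.1 this]

/-- If a set is almost invariant under the coordinate rotations and under the translations
along the coordinate axes by `τ`, then its spectral measure is concentrated on low frequencies. -/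
theorem specMeasure_triple_le {Z : Set (EucSp n)} (hZ : MeasurableSet Z) (hf : volume Z ≠ ⊤)
    {τ ε : ℝ} (h0 : 0 ≤ ε) (h1 : ε ≤ 1)
    (ht : ∀ i : Fin n, volume (symmDiff ((· + EuclideanSpace.single i τ) ⁻¹' Z) Z)
      ≤ ENNReal.ofReal (ε ^ 2) * volume Z)
    (hr : ∀ (i j : Fin n) (h : i ≠ j), volume (symmDiff (rot h ⁻¹' Z) Z)
      ≤ ENNReal.ofReal (ε ^ 2) * volume Z) (t : Fin 3 ↪ Fin n) :
    (specMeasure Z).real {ξ | ∃ k, 1 / 20 < |τ * ξ (t k)|} ≤ 309 * ε * volume.real Z := by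
  have hfin : IsFiniteMeasure (specMeasure Z) :=
    ⟨by rw [specMeasure_univ hZ hf]; exact hf.lt_top⟩
  have ha : 0 ≤ volume.real Z := measureReal_nonneg
  set m := specMeasure Z
  let N := roundTriple t τ
  have hN : Measurable N := measurable_roundTriple t τ
  let q : EucSp n → Fin 3 → ℚ_[5] := fun ξ k => (N ξ k : ℚ_[5])
  have hq : ∀ P : (Fin 3 → ℚ_[5]) → Prop, MeasurableSet {ξ | P (q ξ)} := fun P =>
    hN (MeasurableSet.of_discrete (s := {z : Fin 3 → ℤ | P fun k => (z k : ℚ_[5])}))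
  let D : Set (EucSp n) := ⋃ k, {ξ | 1 / 20 < |τ * ξ (t k) - N ξ k|}
  have hD : MeasurableSet D := by
    refine MeasurableSet.iUnion fun k => measurableSet_lt measurable_const ?_
    refine (Measurable.sub ?_ ?_).abs
    · exact Continuous.measurable (by fun_prop)
    · exact (measurable_from_top (f := fun z : ℤ => (z : ℝ))).comp
        ((measurable_pi_apply k).comp hN)
  have hDm : m.real D ≤ 75 * ε * volume.real Z := by
    calc m.real D ≤ ∑ k, m.real {ξ | 1 / 20 < |τ * ξ (t k) - N ξ k|} :=
          measureReal_iUnion_fintype_le _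
      _ ≤ ∑ _k : Fin 3, 25 * ε ^ 2 * volume.real Z :=
          Finset.sum_le_sum fun k _ => specMeasure_far_le hZ hf (t k) (ht (t k))
      _ = 75 * ε ^ 2 * volume.real Z := by simp; ring
      _ ≤ _ := by gcongr; nlinarith
  have hDc : ∀ ξ, ξ ∉ D → ∀ k, |τ * ξ (t k) - N ξ k| ≤ 1 / 20 := fun ξ hξ k => by
    by_contra h
    exact hξ (mem_iUnion.2 ⟨k, not_le.1 h⟩)
  let W : Set (EucSp n) := {ξ | q ξ ≠ 0} \ D
  have hW : MeasurableSet W := (hq (· ≠ 0)).diff hD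
  let K : Fin 3 × Fin 3 → Set (EucSp n) := fun p => {ξ | ‖rotFun p.1 p.2 (q ξ)‖ ≤ ‖q ξ‖} ∩ W
  have hK : ∀ p, MeasurableSet (K p) := fun p =>
    (hq fun z => ‖rotFun p.1 p.2 z‖ ≤ ‖z‖).inter hW
  have hstep : ∀ p ∈ (Finset.univ : Finset (Fin 3)).offDiag,
      m.real W ≤ m.real (K p) + m.real (K p.swap) + 78 * ε * volume.real Z := by
    intro p hp
    have hp' : p.1 ≠ p.2 := by simpa using hp
    have hsub : W ⊆ K p ∪ (rot (t.injective.ne hp'.symm)).symm ⁻¹' (D ∪ K p.swap) := by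
      intro ξ hξ
      by_cases h2 : ‖rotFun p.1 p.2 (q ξ)‖ ≤ ‖q ξ‖
      · exact Or.inl ⟨h2, hξ⟩
      right
      have e : (rot (t.injective.ne hp'.symm)).symm ξ = tripleRot t p • ξ := by
        rw [tripleRot, dif_pos hp']
        rfl
      rw [mem_preimage, e]
      by_cases h3 : tripleRot t p • ξ ∈ D
      · exact Or.inl h3
      right
      have e2 : q (tripleRot t p • ξ) = rotFun p.1 p.2 (q ξ) :=
        rotFun_roundTriple t hp' (hDc ξ hξ.2) (hDc _ h3)
      refine ⟨?_, ?_, h3⟩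
      · rw [mem_ofPred_eq, e2, Prod.fst_swap, Prod.snd_swap, rotFun_rotFun hp']
        exact (not_le.1 h2).le
      · rw [mem_ofPred_eq, e2]
        exact rotFun_ne_zero hp' hξ.1
    have h2 := specMeasure_preimage_symm_le hZ hf _ (hD.union (hK p.swap)) h0 h1
      (hr _ _ (t.injective.ne hp'.symm))
    calc m.real W ≤ _ := measureReal_mono hsub
      _ ≤ _ := measureReal_union_le _ _
      _ ≤ m.real (K p) + (m.real D + m.real (K p.swap) + 3 * ε * volume.real Z) := by
        gcongr
        exact h2.trans (by gcongr; exact measureReal_union_le _ _)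
      _ ≤ _ := by linarith
  have hsum : ∑ p ∈ (Finset.univ : Finset (Fin 3)).offDiag, m.real (K p) ≤ 2 * m.real W := by
    have e1 : ∀ S, MeasurableSet S → m.real S = ∫ ξ, S.indicator (fun _ => (1 : ℝ)) ξ ∂m :=
      fun S hS => by rw [integral_indicator hS]; simp
    have hi : ∀ S, MeasurableSet S → Integrable (S.indicator fun _ => (1 : ℝ)) m :=
      fun S hS => (integrable_const 1).indicator hS
    rw [Finset.sum_congr rfl fun p _ => e1 (K p) (hK p), e1 W hW, ← integral_const_mul,
      ← integral_finsetSum _ fun p _ => hi (K p) (hK p)]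
    refine integral_mono (integrable_finsetSum _ fun p _ => hi (K p) (hK p))
      ((hi W hW).const_mul 2) fun ξ => ?_
    by_cases hξ : ξ ∈ W
    · classical
      have h2 := card_nonexpanding_le hξ.1
      have h3 : ∀ p, (K p).indicator (fun _ => (1 : ℝ)) ξ =
          if ‖rotFun p.1 p.2 (q ξ)‖ ≤ ‖q ξ‖ then 1 else 0 := fun p => by
        simp [indicator, K, hξ]
      simp only [h3, indicator_of_mem hξ]
      rw [Finset.sum_boole]
      simpa using (Nat.cast_le (α := ℝ)).2 h2
    · rw [indicator_of_notMem hξ, Finset.sum_eq_zero fun p _ =>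
        indicator_of_notMem (fun h => hξ h.2) _]
      simp
  have hsum2 : ∑ p ∈ (Finset.univ : Finset (Fin 3)).offDiag, m.real (K p.swap)
      ≤ 2 * m.real W := by
    refine le_trans (le_of_eq ?_) hsum
    refine Finset.sum_equiv (Equiv.prodComm _ _) (fun p => ?_) fun p _ => rfl
    simp [ne_comm]
  have hWm : m.real W ≤ 234 * ε * volume.real Z := by
    have h2 := Finset.sum_le_sum hstep
    simp only [Finset.sum_add_distrib, Finset.sum_const, nsmul_eq_mul] at h2
    rw [show (Finset.univ : Finset (Fin 3)).offDiag.card = 6 by decide] at h2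
    push_cast at h2
    linarith
  have hfinal : {ξ : EucSp n | ∃ k, 1 / 20 < |τ * ξ (t k)|} ⊆ D ∪ W := by
    rintro ξ ⟨k, hk⟩
    by_cases hξ : ξ ∈ D
    · exact Or.inl hξ
    refine Or.inr ⟨fun h2 => ?_, hξ⟩
    have h3 := hDc ξ hξ k
    have h4 : N ξ k = 0 := by
      have : (N ξ k : ℚ_[5]) = 0 := congrFun h2 k
      exact_mod_cast this
    rw [h4, Int.cast_zero, sub_zero] at h3
    exact absurd hk (not_lt.2 h3)
  calc _ ≤ _ := measureReal_mono hfinal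
    _ ≤ _ := measureReal_union_le _ _
    _ ≤ _ := by linarith

end PingPong

section LowFrequency

open ENNReal in
/-- If almost all translates by small vectors barely change `Z`, then `Z` almost fills a ball. -/
theorem exists_ball_sdiff_le {n : ℕ} {Z : Set (EucSp n)} (hZ : MeasurableSet Z)
    (h0 : volume Z ≠ 0) (hf : volume Z ≠ ⊤) {R : ℝ} {c : ℝ≥0∞}
    (h : ∀ w : EucSp n, ‖w‖ < R → volume (symmDiff ((· + w) ⁻¹' Z) Z) ≤ c * volume Z) :
    ∃ z ∈ Z, volume (Metric.ball z R \ Z) ≤ c * volume (Metric.ball (0 : EucSp n) R) := by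
  set U := Metric.ball (0 : EucSp n) R
  have hU : MeasurableSet U := measurableSet_ball
  let F : EucSp n → EucSp n → ℝ≥0∞ := fun z w => Zᶜ.indicator 1 (z + w)
  have hF : Measurable (Function.uncurry F) :=
    (measurable_one.indicator hZ.compl).comp (measurable_fst.add measurable_snd)
  have e1 : ∀ z, ∫⁻ w in U, F z w = volume (Metric.ball z R \ Z) := fun z => by
    have h1 : ∀ w, F z w = ((z + ·) ⁻¹' Zᶜ).indicator 1 w := fun w => rfl
    have hm : MeasurableSet ((z + ·) ⁻¹' Zᶜ) := measurable_const_add z hZ.compl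
    rw [lintegral_congr h1, lintegral_indicator_one hm, Measure.restrict_apply hm]
    rw [← measure_preimage_add volume z (Metric.ball z R \ Z)]
    congr 1
    ext w
    simp [U, and_comm]
  have e2 : ∀ w, ∫⁻ z in Z, F z w ≤ volume (symmDiff ((· + w) ⁻¹' Z) Z) := fun w => by
    have h1 : ∀ z, F z w = ((· + w) ⁻¹' Zᶜ).indicator 1 z := fun z => rfl
    have hm : MeasurableSet ((· + w) ⁻¹' Zᶜ) := measurable_add_const w hZ.compl
    rw [lintegral_congr h1, lintegral_indicator_one hm, Measure.restrict_apply hm]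
    exact measure_mono fun z hz => Or.inr ⟨hz.2, hz.1⟩
  obtain ⟨z, hz, hle⟩ := exists_le_setLAverage h0 hf
    (f := fun z => ∫⁻ w in U, F z w) (hF.lintegral_prod_right').aemeasurable
  refine ⟨z, hz, ?_⟩
  rw [← e1]
  refine hle.trans ?_
  rw [setLAverage_eq, lintegral_lintegral_swap hF.aemeasurable]
  refine ENNReal.div_le_of_le_mul ?_
  calc ∫⁻ w in U, ∫⁻ z in Z, F z w ≤ ∫⁻ _w in U, c * volume Z :=
        setLIntegral_mono measurable_const fun w hw => (e2 w).trans (h w (by simpa [U] using hw))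
    _ = c * volume U * volume Z := by rw [setLIntegral_const]; ring

variable {n : ℕ}

theorem specMeasure_low_le (hn : 3 ≤ n) {Z : Set (EucSp n)} (hZ : MeasurableSet Z)
    (hf : volume Z ≠ ⊤) {τ ε : ℝ} (h0 : 0 ≤ ε) (h1 : ε ≤ 1)
    (ht : ∀ i : Fin n, volume (symmDiff ((· + EuclideanSpace.single i τ) ⁻¹' Z) Z)
      ≤ ENNReal.ofReal (ε ^ 2) * volume Z)
    (hr : ∀ (i j : Fin n) (h : i ≠ j), volume (symmDiff (rot h ⁻¹' Z) Z)
      ≤ ENNReal.ofReal (ε ^ 2) * volume Z) :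
    specMeasure Z {ξ | ∃ i, 1 / 20 < |τ * ξ i|} ≤ ENNReal.ofReal (309 * n * ε) * volume Z := by
  have hfin : IsFiniteMeasure (specMeasure Z) :=
    ⟨by rw [specMeasure_univ hZ hf]; exact hf.lt_top⟩
  have hi : ∀ i, (specMeasure Z).real {ξ | 1 / 20 < |τ * ξ i|} ≤ 309 * ε * volume.real Z := by
    intro i
    let t : Fin 3 ↪ Fin n := (Fin.castLEEmb hn).trans
      (Equiv.swap (Fin.castLE hn 0) i).toEmbedding
    refine le_trans (measureReal_mono fun ξ hξ => ?_) (specMeasure_triple_le hZ hf h0 h1 ht hr t)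
    refine ⟨0, ?_⟩
    have : t 0 = i := by simp [t]
    rw [this]
    exact hξ
  have h2 : (specMeasure Z).real {ξ | ∃ i, 1 / 20 < |τ * ξ i|}
      ≤ 309 * n * ε * volume.real Z := by
    rw [ofPred_exists]
    refine (measureReal_iUnion_fintype_le _).trans ((Finset.sum_le_sum fun i _ => hi i).trans ?_)
    simp
    linarith
  rw [← ofReal_measureReal, ← ofReal_measureReal (μ := volume) (h := hf),
    ← ENNReal.ofReal_mul (by positivity)]
  exact ENNReal.ofReal_le_ofReal h2

/-- Almost invariance under the coordinate rotations and some large translations implies almost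
invariance under all small translations. -/
theorem volume_symmDiff_preimage_add_le (hn : 3 ≤ n) {Z : Set (EucSp n)} (hZ : MeasurableSet Z)
    (hf : volume Z ≠ ⊤) {τ ε R : ℝ} (hτ : 0 < τ) (hR : 0 < R) (h0 : 0 ≤ ε) (h1 : ε ≤ 1)
    (ht : ∀ i : Fin n, volume (symmDiff ((· + EuclideanSpace.single i τ) ⁻¹' Z) Z)
      ≤ ENNReal.ofReal (ε ^ 2) * volume Z)
    (hr : ∀ (i j : Fin n) (h : i ≠ j), volume (symmDiff (rot h ⁻¹' Z) Z)
      ≤ ENNReal.ofReal (ε ^ 2) * volume Z) {w : EucSp n} (hw : ‖w‖ < R) :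
    volume (symmDiff ((· + w) ⁻¹' Z) Z)
      ≤ ENNReal.ofReal ((n * R / τ) ^ 2 + 1236 * n * ε) * volume Z := by
  rw [← lintegral_fourierChar_sub_one hZ hf w]
  set D : Set (EucSp n) := {ξ | ∃ i, 1 / 20 < |τ * ξ i|} with hD
  have hDm : MeasurableSet D := by
    rw [hD, ofPred_exists]
    refine MeasurableSet.iUnion fun i => measurableSet_lt measurable_const ?_
    exact Continuous.measurable (by fun_prop)
  have hpt : ∀ ξ, ‖(Real.fourierChar (inner ℝ w ξ) : ℂ) - 1‖ₑ ^ 2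
      ≤ ENNReal.ofReal ((n * R / τ) ^ 2) + D.indicator (fun _ => 4) ξ := by
    intro ξ
    by_cases hξ : ξ ∈ D
    · rw [indicator_of_mem hξ]
      refine le_trans ?_ le_add_self
      have h2 : ‖(Real.fourierChar (inner ℝ w ξ) : ℂ) - 1‖ ≤ 2 :=
        (norm_sub_le _ _).trans (by rw [Circle.norm_coe, norm_one]; norm_num)
      rw [← ofReal_norm, ← ENNReal.ofReal_pow (norm_nonneg _)]
      refine (ENNReal.ofReal_le_ofReal (pow_le_pow_left₀ (norm_nonneg _) h2 2)).trans ?_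
      norm_num
    · rw [indicator_of_notMem hξ, add_zero, ← ofReal_norm,
        ← ENNReal.ofReal_pow (norm_nonneg _)]
      refine ENNReal.ofReal_le_ofReal (pow_le_pow_left₀ (norm_nonneg _) ?_ 2)
      have hξ' : ∀ i, |ξ i| ≤ 1 / (20 * τ) := fun i => by
        have h2 : |τ * ξ i| ≤ 1 / 20 := by
          by_contra h
          exact hξ ⟨i, not_le.1 h⟩
        rw [abs_mul, abs_of_pos hτ] at h2
        rw [le_div_iff₀ (by positivity)]
        linarith
      have hin : |inner ℝ w ξ| ≤ n * (R * (1 / (20 * τ))) := by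
        rw [PiLp.inner_apply]
        refine (Finset.abs_sum_le_sum_abs _ _).trans ?_
        calc _ ≤ ∑ _i : Fin n, R * (1 / (20 * τ)) := Finset.sum_le_sum fun i _ => by
              have h3 : |w i| ≤ R := (PiLp.norm_apply_le w i).trans hw.le
              simp only [RCLike.inner_apply, conj_trivial]
              rw [abs_mul, mul_comm]
              exact mul_le_mul h3 (hξ' i) (abs_nonneg _) hR.le
          _ = _ := by simp
      have h4 : ‖(Real.fourierChar (inner ℝ w ξ) : ℂ) - 1‖ ≤ 2 * Real.pi * |inner ℝ w ξ| := by
        rw [Real.fourierChar_apply]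
        have := Real.norm_exp_I_mul_ofReal_sub_one_le (x := 2 * Real.pi * inner ℝ w ξ)
        rw [Real.norm_eq_abs, abs_mul, abs_of_pos Real.two_pi_pos, mul_comm Complex.I] at this
        exact this
      refine h4.trans ?_
      have h5 : 2 * Real.pi ≤ 20 := by linarith [Real.pi_lt_four]
      calc 2 * Real.pi * |inner ℝ w ξ| ≤ 20 * (n * (R * (1 / (20 * τ)))) := by gcongr
        _ = n * R / τ := by field_simp
  calc _ ≤ ∫⁻ ξ, ENNReal.ofReal ((n * R / τ) ^ 2) + D.indicator (fun _ => 4) ξ ∂specMeasure Z :=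
        lintegral_mono hpt
    _ = ENNReal.ofReal ((n * R / τ) ^ 2) * volume Z + 4 * specMeasure Z D := by
        rw [lintegral_add_left measurable_const, lintegral_const, specMeasure_univ hZ hf,
          lintegral_indicator_const hDm]
    _ ≤ ENNReal.ofReal ((n * R / τ) ^ 2) * volume Z +
          4 * (ENNReal.ofReal (309 * n * ε) * volume Z) := by
        gcongr
        exact specMeasure_low_le hn hZ hf h0 h1 ht hr
    _ = _ := by
        rw [ENNReal.ofReal_add (by positivity) (by positivity), add_mul, ← mul_assoc,
          show (1236 * n * ε : ℝ) = 4 * (309 * n * ε) by ring,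
          ENNReal.ofReal_mul (p := 4) (by norm_num)]
        norm_num

end LowFrequency

section Expansion

open scoped ENNReal

theorem measurableSet_finset_smul {G α : Type*} [Group G] [MulAction G α] [MeasurableSpace α]
    [MeasurableConstSMul G α] (S : Finset G) {X : Set α} (hX : MeasurableSet X) :
    MeasurableSet ((S : Set G) • X) := by
  rw [← iUnion_smul_set]
  exact S.measurableSet_biUnion fun g _ => hX.const_smul g

variable {n : ℕ}

/-- A finite set of isometries either expands a set or the set almost fills a ball. -/
theorem exists_finset_expand_or_fill (hn : 3 ≤ n) {R : ℝ} (hR : 0 < R) {η : ℝ≥0∞} (hη : η ≠ 0) :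
    ∃ (S : Finset (EucSp n ≃ᵢ EucSp n)) (τ δ : ℝ), 0 < τ ∧ 0 < δ ∧ 1 ∈ S ∧
      (∀ g ∈ S, ∀ x : EucSp n, ‖g • x‖ ≤ ‖x‖ + τ) ∧
      ∀ Z : Set (EucSp n), MeasurableSet Z → volume Z ≠ ⊤ →
        ENNReal.ofReal (1 + δ) * volume Z ≤ volume ((S : Set (EucSp n ≃ᵢ EucSp n)) • Z) ∨
          ∃ z ∈ Z, volume (Metric.ball z R \ Z) ≤ η := by
  classical
  obtain ⟨c, hc, hcη⟩ := ENNReal.exists_nnreal_pos_mul_lt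
    (measure_ball_lt_top (μ := volume) (x := (0 : EucSp n)) (r := R)).ne hη
  have hn0 : (0 : ℝ) < n := by exact_mod_cast (by omega : 0 < n)
  have hc0 : (0 : ℝ) < c := hc
  set b : ℝ := min 1 (c / 2)
  have hb : 0 < b := lt_min one_pos (by positivity)
  set τ : ℝ := n * R / b
  have hτ : 0 < τ := by positivity
  set ε : ℝ := min 1 (c / (2 * (1236 * n)))
  have hε : 0 < ε := lt_min one_pos (by positivity)
  have hε1 : ε ≤ 1 := min_le_left _ _
  have hbound : (n * R / τ) ^ 2 + 1236 * n * ε ≤ c := by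
    have e1 : n * R / τ = b := by simp only [τ]; field_simp
    have e2 : b ^ 2 ≤ c / 2 := by
      nlinarith [min_le_left 1 ((c : ℝ) / 2), min_le_right 1 ((c : ℝ) / 2)]
    have e3 : ε * (2 * (1236 * n)) ≤ c := by
      rw [← le_div_iff₀ (by positivity)]
      exact min_le_right _ _
    rw [e1]
    linarith
  let ρ : Fin n × Fin n → (EucSp n ≃ᵢ EucSp n) := fun p =>
    if h : p.1 ≠ p.2 then (rot h).toIsometryEquiv else 1
  let S : Finset (EucSp n ≃ᵢ EucSp n) := insert 1 (Finset.univ.image ρ ∪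
    Finset.univ.image fun i => transl (EuclideanSpace.single i τ))
  have hS1 : 1 ∈ S := Finset.mem_insert_self _ _
  have hSρ : ∀ p, ρ p ∈ S := fun p => Finset.mem_insert_of_mem
    (Finset.mem_union_left _ (Finset.mem_image_of_mem _ (Finset.mem_univ p)))
  have hSt : ∀ i, transl (EuclideanSpace.single i τ) ∈ S := fun i => Finset.mem_insert_of_mem
    (Finset.mem_union_right _ (Finset.mem_image.2 ⟨i, Finset.mem_univ i, rfl⟩))
  have hSmem : ∀ g ∈ S, g = 1 ∨ (∃ p, ρ p = g) ∨ ∃ i, transl (EuclideanSpace.single i τ) = g := by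
    simp [S]
  clear_value S
  refine ⟨S, τ, ε ^ 2 / 2, hτ, by positivity, hS1, fun g hg x => ?_, fun Z hZ hf => ?_⟩
  · rcases hSmem g hg with rfl | ⟨p, rfl⟩ | ⟨i, rfl⟩
    · rw [one_smul]
      linarith
    · have h0 : ρ p • (0 : EucSp n) = 0 := by
        simp only [ρ]
        split_ifs with h
        · exact map_zero (rot h)
        · rfl
      rw [norm_smul_of_map_zero h0]
      linarith
    · rw [transl_smul]
      refine (norm_add_le _ _).trans ?_
      rw [PiLp.norm_single, Real.norm_eq_abs, abs_of_pos hτ]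
  by_cases h0 : volume Z = 0
  · left
    simp [h0]
  by_cases hleft : ENNReal.ofReal (1 + ε ^ 2 / 2) * volume Z
      ≤ volume ((S : Set (EucSp n ≃ᵢ EucSp n)) • Z)
  · exact Or.inl hleft
  right
  have hsymm : ∀ g ∈ S,
      volume (symmDiff ((g • ·) ⁻¹' Z) Z) ≤ ENNReal.ofReal (ε ^ 2) * volume Z := by
    intro g hg
    have hgZ : MeasurableSet (g • Z) := hZ.const_smul g
    have hd : volume (g • Z \ Z) ≤ ENNReal.ofReal (ε ^ 2 / 2) * volume Z := by
      have h1 : volume Z + volume (g • Z \ Z) ≤ volume ((S : Set (EucSp n ≃ᵢ EucSp n)) • Z) := by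
        rw [← measure_union disjoint_sdiff_right (hgZ.diff hZ)]
        refine measure_mono (union_subset (fun z hz => ?_) fun z hz => ?_)
        · exact mem_smul.2 ⟨1, hS1, z, hz, one_smul _ _⟩
        · obtain ⟨y, hy, rfl⟩ := hz.1
          exact mem_smul.2 ⟨g, hg, y, hy, rfl⟩
      have h2 := h1.trans (not_le.1 hleft).le
      rw [ENNReal.ofReal_add one_pos.le (by positivity), add_mul, ENNReal.ofReal_one, one_mul] at h2
      exact (ENNReal.add_le_add_iff_left hf).1 h2
    have hd' : volume (Z \ g • Z) = volume (g • Z \ Z) := by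
      have h1 := measure_inter_add_sdiff Z hgZ (μ := volume)
      have h2 := measure_inter_add_sdiff (g • Z) hZ (μ := volume)
      rw [measure_smul, inter_comm] at h2
      have h3 : volume (Z ∩ g • Z) ≠ ⊤ := ne_top_of_le_ne_top hf (measure_mono inter_subset_left)
      exact (ENNReal.add_right_inj h3).1 (h1.trans h2.symm)
    rw [preimage_smul, measure_inv_smul_symmDiff]
    refine (measure_union_le _ _).trans ?_
    rw [hd']
    refine (add_le_add hd hd).trans (le_of_eq ?_)
    rw [← add_mul, ← ENNReal.ofReal_add (by positivity) (by positivity), add_halves]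
  have hsmall : ∀ w : EucSp n, ‖w‖ < R → volume (symmDiff ((· + w) ⁻¹' Z) Z) ≤ c * volume Z := by
    intro w hw
    refine (volume_symmDiff_preimage_add_le hn hZ hf hτ hR hε.le hε1 (fun i => ?_)
      (fun i j h => ?_) hw).trans ?_
    · exact hsymm _ (hSt i)
    · have e : (rot h ⁻¹' Z) = ((ρ (i, j) • ·) ⁻¹' Z) := by
        simp only [ρ]
        rw [dif_pos h]
        rfl
      rw [e]
      exact hsymm _ (hSρ (i, j))
    · gcongr
      rw [← ENNReal.ofReal_coe_nnreal]
      exact ENNReal.ofReal_le_ofReal hbound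
  obtain ⟨z, hz, hle⟩ := exists_ball_sdiff_le hZ h0 hf hsmall
  exact ⟨z, hz, hle.trans hcη.le⟩

/-- A grid of balls covering a large ball, of polynomial size. -/
theorem exists_finset_cover_ball (hn : 0 < n) {r : ℝ} (hr : 0 < r) {ρ : ℝ} {L : ℕ}
    (hL : n * ρ / r + 1 ≤ L) :
    ∃ T : Finset (EucSp n), T.card ≤ (2 * L + 1) ^ n ∧
      ∀ x : EucSp n, ‖x‖ < ρ → ∃ v ∈ T, dist x v < r := by
  classical
  have hn0 : (0 : ℝ) < n := by exact_mod_cast hn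
  set s : ℝ := r / n
  have hs : 0 < s := by positivity
  refine ⟨(Fintype.piFinset fun _ : Fin n => Finset.Icc (-(L : ℤ)) L).image
    fun a => WithLp.toLp 2 fun i => s * a i, ?_, fun x hx =>
    ⟨_, Finset.mem_image_of_mem _ (Fintype.mem_piFinset.2 fun i => ?_ :
      (fun i => round (x i / s)) ∈ _), ?_⟩⟩
  · refine Finset.card_image_le.trans (le_of_eq ?_)
    rw [Fintype.card_piFinset_const, Int.card_Icc]
    congr 1
    omega
  · have h1 : |x i / s| ≤ n * ρ / r := by
      rw [abs_div, abs_of_pos hs, div_le_div_iff₀ hs hr]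
      have h2 : |x i| ≤ ρ := (PiLp.norm_apply_le x i).trans hx.le
      calc |x i| * r ≤ ρ * r := by gcongr
        _ = n * ρ * s := by simp only [s]; field_simp
    have h3 := abs_le.1 h1
    have h4 := abs_le.1 (abs_sub_round (x i / s))
    rw [Finset.mem_Icc]
    constructor
    · have : (-(L : ℝ)) ≤ round (x i / s) := by linarith
      exact_mod_cast this
    · have : (round (x i / s) : ℝ) ≤ L := by linarith
      exact_mod_cast this
  · change dist x (WithLp.toLp 2 fun i => s * (round (x i / s) : ℝ)) < r
    rw [dist_eq_norm, ← sq_lt_sq₀ (norm_nonneg _) hr.le, EuclideanSpace.norm_sq_eq]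
    have h1 : ∀ i, ‖(x - WithLp.toLp 2 fun i => s * (round (x i / s) : ℝ)) i‖ ^ 2
        ≤ (s / 2) ^ 2 := fun i => by
      refine pow_le_pow_left₀ (norm_nonneg _) ?_ 2
      have h4 := abs_sub_round (x i / s)
      simp only [PiLp.sub_apply, Real.norm_eq_abs]
      have e : x i - s * (round (x i / s) : ℝ) = s * (x i / s - round (x i / s)) := by
        field_simp
      rw [e, abs_mul, abs_of_pos hs]
      nlinarith
    calc _ ≤ ∑ _i : Fin n, (s / 2) ^ 2 := Finset.sum_le_sum fun i _ => h1 i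
      _ = r ^ 2 / (4 * n) := by simp [s]; field_simp; norm_num
      _ < r ^ 2 := by
        rw [div_lt_iff₀ (by positivity)]
        have : (1 : ℝ) ≤ n := by exact_mod_cast hn
        nlinarith [sq_pos_of_pos hr]

end Expansion

section LocalExpansion

open scoped ENNReal

variable {n : ℕ}

theorem exists_polynomial_le_pow {δ : ℝ} (hδ : 0 < δ) (C K n : ℕ) :
    ∃ M : ℕ, 1 ≤ M ∧ (C : ℝ) * (K * M) ^ n ≤ (1 + δ) ^ M := by
  have ht := tendsto_pow_const_div_const_pow_of_one_lt n (by linarith : 1 < 1 + δ)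
  have hpos : (0 : ℝ) < 1 / (C * K ^ n + 1) := by positivity
  obtain ⟨M, h, hM⟩ := ((ht.eventually (gt_mem_nhds hpos)).and
    (Filter.eventually_ge_atTop 1)).exists
  refine ⟨M, hM, ?_⟩
  rw [div_lt_div_iff₀ (by positivity) (by positivity)] at h
  rw [mul_pow]
  have : (0 : ℝ) ≤ (M : ℝ) ^ n := by positivity
  nlinarith

theorem transl_smul_ball (v : EucSp n) (x : EucSp n) (r : ℝ) :
    transl v • Metric.ball x r = Metric.ball (x + v) r := by
  rw [Metric.smul_ball, transl_smul]

/-- A finite set of isometries either expands subsets of a ball inside the ball, or maps them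
to almost the full ball. -/
theorem exists_finset_expand_or_fill_ball (hn : 3 ≤ n) {r : ℝ} (hr : 0 < r) (C : ℕ) {η : ℝ≥0∞}
    (hη : η ≠ 0) :
    ∃ S : Finset (EucSp n ≃ᵢ EucSp n), ∀ Y ⊆ Metric.ball (0 : EucSp n) r, MeasurableSet Y →
      C * volume Y ≤ volume ((S : Set (EucSp n ≃ᵢ EucSp n)) • Y ∩ Metric.ball 0 r) ∨
        volume (Metric.ball 0 r \ (S : Set (EucSp n ≃ᵢ EucSp n)) • Y) ≤ η := by
  classical
  obtain ⟨S, τ, δ, hτ, hδ, hS1, hSτ, hS⟩ :=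
    exists_finset_expand_or_fill hn (by positivity : 0 < 2 * r) hη
  set q : ℕ := ⌈n * τ / r⌉₊
  obtain ⟨M, hM1, hM⟩ := exists_polynomial_le_pow hδ C (2 * n + 3 + 2 * q) n
  obtain ⟨T, hTcard, hT⟩ := exists_finset_cover_ball (n := n) (by omega) hr
    (ρ := r + M * τ) (L := n + 1 + M * q) (by
      have h1 : n * τ / r ≤ q := Nat.le_ceil _
      have h2 : n * (r + M * τ) / r = n + M * (n * τ / r) := by field_simp
      rw [h2]
      push_cast
      have := mul_le_mul_of_nonneg_left h1 (Nat.cast_nonneg (α := ℝ) M)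
      linarith)
  have hC : (C : ℝ) * T.card ≤ (1 + δ) ^ M := by
    refine le_trans ?_ hM
    gcongr
    have : (T.card : ℝ) ≤ ((2 * (n + 1 + M * q) + 1 : ℕ) : ℝ) ^ n := by exact_mod_cast hTcard
    refine this.trans (pow_le_pow_left₀ (by positivity) ?_ n)
    have hM' : (1 : ℝ) ≤ M := by exact_mod_cast hM1
    have hn' : (0 : ℝ) ≤ n := by positivity
    push_cast
    nlinarith
  refine ⟨T.image (fun v => transl (-v)) * S ^ M, fun Y hYr hY => ?_⟩
  set Z : ℕ → Set (EucSp n) := fun k => ((S ^ k : Finset _) : Set (EucSp n ≃ᵢ EucSp n)) • Y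
    with hZdef
  have hZsucc : ∀ k, Z (k + 1) = (S : Set (EucSp n ≃ᵢ EucSp n)) • Z k := fun k => by
    simp only [hZdef, pow_succ', Finset.coe_mul, mul_smul]
  have hZ0 : Z 0 = Y := by simp [hZdef]
  have hZm : ∀ k, MeasurableSet (Z k) := fun k => measurableSet_finset_smul _ hY
  have hZball : ∀ k, ∀ z ∈ Z k, ‖z‖ < r + k * τ := by
    intro k
    induction k with
    | zero =>
      intro z hz
      rw [hZ0] at hz
      simpa using hYr hz
    | succ k ih =>
      intro z hz
      rw [hZsucc] at hz
      obtain ⟨g, hg, y, hy, rfl⟩ := mem_smul.1 hz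
      have := hSτ g hg y
      have := ih y hy
      push_cast
      linarith
  have hZfin : ∀ k, volume (Z k) ≠ ⊤ := fun k =>
    (Bornology.IsBounded.measure_lt_top ((Metric.isBounded_ball (x := (0 : EucSp n))
      (r := r + k * τ)).subset fun z hz => by simpa using hZball k z hz)).ne
  have hZmono : ∀ k ≤ M, Z k ⊆ Z M := fun k hk => by
    refine smul_subset_smul_right ?_
    exact_mod_cast Finset.pow_subset_pow_right hS1 hk
  have hsub : ∀ v ∈ T, transl (-v) • Z M
      ⊆ ((T.image (fun v => transl (-v)) * S ^ M : Finset _) : Set (EucSp n ≃ᵢ EucSp n)) • Y := by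
    intro v hv
    rw [Finset.coe_mul, mul_smul]
    exact smul_set_subset_smul (Finset.mem_coe.2 (Finset.mem_image_of_mem _ hv))
  have hball : ∀ v : EucSp n, transl (-v) • Metric.ball v r = Metric.ball 0 r := fun v => by
    rw [transl_smul_ball, add_neg_cancel]
  by_cases hgrow : ∀ k < M, ENNReal.ofReal (1 + δ) * volume (Z k) ≤ volume (Z (k + 1))
  · left
    have hpow : ∀ k ≤ M, ENNReal.ofReal ((1 + δ) ^ k) * volume Y ≤ volume (Z k) := by
      intro k
      induction k with
      | zero => simp [hZ0]
      | succ k ih =>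
        intro hk
        refine le_trans ?_ (hgrow k hk)
        rw [pow_succ', ENNReal.ofReal_mul (by positivity), mul_assoc]
        gcongr
        exact ih (by omega)
    have hTne : T.Nonempty := by
      obtain ⟨v, hv, -⟩ := hT 0 (by simpa using by positivity)
      exact ⟨v, hv⟩
    have hex : ∃ v ∈ T, C * volume Y ≤ volume (Z M ∩ Metric.ball v r) := by
      by_contra! hcon
      have h1 := ENNReal.sum_lt_sum_of_nonempty hTne hcon
      have h2 : volume (Z M) ≤ ∑ v ∈ T, volume (Z M ∩ Metric.ball v r) := by
        refine le_trans (measure_mono fun z hz => ?_) (measure_biUnion_finset_le T _)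
        obtain ⟨v, hv, hd⟩ := hT z (hZball M z hz)
        exact mem_biUnion hv ⟨hz, hd⟩
      refine absurd ((hpow M le_rfl).trans h2) (not_le.2 (h1.trans_le ?_))
      rw [Finset.sum_const, nsmul_eq_mul, ← mul_assoc]
      gcongr
      rw [← ENNReal.ofReal_natCast, ← ENNReal.ofReal_natCast C,
        ← ENNReal.ofReal_mul (Nat.cast_nonneg _), mul_comm]
      exact ENNReal.ofReal_le_ofReal hC
    obtain ⟨v, hv, hle⟩ := hex
    refine hle.trans ?_
    rw [← measure_smul volume (transl (-v)), smul_set_inter, hball]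
    exact measure_mono (inter_subset_inter_left _ (hsub v hv))
  · right
    push Not at hgrow
    obtain ⟨k, hk, hlt⟩ := hgrow
    rw [hZsucc] at hlt
    obtain ⟨z, hz, hle⟩ := (hS (Z k) (hZm k) (hZfin k)).resolve_left (not_le.2 hlt)
    obtain ⟨v, hv, hd⟩ := hT z (hZball M z (hZmono k hk.le hz))
    refine le_trans ?_ hle
    rw [← measure_smul volume (transl (-v)) (Metric.ball z (2 * r) \ Z k), smul_set_sdiff]
    refine measure_mono ?_
    rw [← hball v]
    refine sdiff_subset_sdiff (smul_set_mono (Metric.ball_subset_ball' ?_))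
      ((smul_set_mono (hZmono k hk.le)).trans (hsub v hv))
    rw [dist_comm]
    linarith

/-- A finite set of isometries either doubles subsets of `A` inside `B`, or maps them
to at least two thirds of `B`. -/
theorem exists_finset_double_or_cover (hn : 3 ≤ n) {A B : Set (EucSp n)}
    (hA : Bornology.IsBounded A) (hB : Bornology.IsBounded B) (hBi : (interior B).Nonempty) :
    ∃ S : Finset (EucSp n ≃ᵢ EucSp n), ∀ X ⊆ A, MeasurableSet X →
      2 * volume X ≤ volume ((S : Set (EucSp n ≃ᵢ EucSp n)) • X ∩ B) ∨
        3 * volume (B \ (S : Set (EucSp n ≃ᵢ EucSp n)) • X) ≤ volume B := by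
  classical
  obtain ⟨z, hz⟩ := hBi
  obtain ⟨r, hr, hzr⟩ := Metric.isOpen_iff.1 isOpen_interior z hz
  replace hzr := hzr.trans interior_subset
  have hcov : ∀ E : Set (EucSp n), Bornology.IsBounded E → ∃ T : Finset (EucSp n), T.Nonempty ∧
      ∀ x ∈ E, ∃ v ∈ T, x ∈ Metric.ball v r := by
    intro E hE
    obtain ⟨ρ, hρ, hEρ⟩ := hE.subset_ball_lt 0 0
    obtain ⟨T, -, hT⟩ := exists_finset_cover_ball (n := n) (by omega) hr
      (ρ := ρ) (L := ⌈n * ρ / r + 1⌉₊) (Nat.le_ceil _)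
    obtain ⟨v, hv, -⟩ := hT 0 (by simpa using hρ)
    exact ⟨T, ⟨v, hv⟩, fun x hx => hT x (by simpa using hEρ hx)⟩
  obtain ⟨F, hFne, hF⟩ := hcov A hA
  obtain ⟨F', -, hF'⟩ := hcov B hB
  have hB0 : volume B ≠ 0 := ((Metric.measure_ball_pos volume z hr).trans_le
    (measure_mono hzr)).ne'
  have hη : volume B / (3 * F'.card) ≠ 0 := by
    rw [ENNReal.div_ne_zero]
    exact ⟨hB0, by finiteness⟩
  obtain ⟨S, hS⟩ := exists_finset_expand_or_fill_ball hn hr (2 * F.card) hη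
  set S' := (insert z F').image transl * S * F.image (fun v => transl (-v))
  refine ⟨S', fun X hXA hX => ?_⟩
  have hmem : ∀ w ∈ insert z F', ∀ v ∈ F, ∀ Y : Set (EucSp n), Y ⊆ X →
      transl w • ((S : Set (EucSp n ≃ᵢ EucSp n)) • (transl (-v) • Y))
        ⊆ (S' : Set (EucSp n ≃ᵢ EucSp n)) • X := by
    intro w hw v hv Y hY
    simp only [S', Finset.coe_mul, mul_smul]
    refine (smul_set_subset_smul (Finset.mem_coe.2 (Finset.mem_image_of_mem _ hw))).trans
      (smul_subset_smul_left (smul_subset_smul_left ?_))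
    exact (smul_set_mono hY).trans
      (smul_set_subset_smul (Finset.mem_coe.2 (Finset.mem_image_of_mem _ hv)))
  set Y : EucSp n → Set (EucSp n) := fun v => transl (-v) • (X ∩ Metric.ball v r)
  have hYr : ∀ v, Y v ⊆ Metric.ball 0 r := fun v => by
    refine (smul_set_mono inter_subset_right).trans ?_
    rw [transl_smul_ball, add_neg_cancel]
  have hYm : ∀ v, MeasurableSet (Y v) := fun v => (hX.inter measurableSet_ball).const_smul _
  by_cases hfill : ∃ v ∈ F, volume (Metric.ball 0 r \ (S : Set (EucSp n ≃ᵢ EucSp n)) • Y v)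
      ≤ volume B / (3 * F'.card)
  · right
    obtain ⟨v, hv, hle⟩ := hfill
    have h1 : volume (B \ (S' : Set (EucSp n ≃ᵢ EucSp n)) • X)
        ≤ ∑ w ∈ F', volume B / (3 * F'.card) := by
      refine le_trans (measure_mono fun x hx => ?_) ((measure_biUnion_finset_le F'
        fun w => transl w • (Metric.ball 0 r \ (S : Set (EucSp n ≃ᵢ EucSp n)) • Y v)).trans
          (Finset.sum_le_sum fun w _ => ?_))
      · obtain ⟨w, hw, hxw⟩ := hF' x hx.1
        refine mem_biUnion hw ?_
        rw [smul_set_sdiff, transl_smul_ball, zero_add]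
        exact ⟨hxw, fun h => hx.2 (hmem w (Finset.mem_insert_of_mem hw) v hv _
          inter_subset_left h)⟩
      · rw [measure_smul]
        exact hle
    rw [Finset.sum_const, nsmul_eq_mul] at h1
    calc 3 * volume (B \ (S' : Set (EucSp n ≃ᵢ EucSp n)) • X)
        ≤ 3 * (F'.card * (volume B / (3 * F'.card))) := by gcongr
      _ = (3 * F'.card) * (volume B / (3 * F'.card)) := by rw [mul_assoc]
      _ ≤ volume B := ENNReal.mul_div_le
  · left
    push Not at hfill
    have hstep : ∀ v ∈ F, (2 * F.card : ℕ) * volume (X ∩ Metric.ball v r)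
        ≤ volume ((S' : Set (EucSp n ≃ᵢ EucSp n)) • X ∩ B) := by
      intro v hv
      have h1 := (hS (Y v) (hYr v) (hYm v)).resolve_right (not_le.2 (hfill v hv))
      rw [show volume (Y v) = volume (X ∩ Metric.ball v r) from measure_smul _ _ _,
        ← measure_smul volume (transl z) ((S : Set (EucSp n ≃ᵢ EucSp n)) • Y v ∩ _),
        smul_set_inter, transl_smul_ball, zero_add] at h1
      exact h1.trans (measure_mono (inter_subset_inter
        (hmem z (Finset.mem_insert_self _ _) v hv _ inter_subset_left) hzr))
    have h2 : volume X ≤ ∑ v ∈ F, volume (X ∩ Metric.ball v r) := by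
      refine le_trans (measure_mono fun x hx => ?_) (measure_biUnion_finset_le F _)
      obtain ⟨v, hv, hd⟩ := hF x (hXA hx)
      exact mem_biUnion hv ⟨hx, hd⟩
    have hc : (F.card : ℝ≥0∞) ≠ 0 := by exact_mod_cast hFne.card_pos.ne'
    refine (ENNReal.mul_le_mul_iff_right hc (ENNReal.natCast_ne_top _)).1 ?_
    calc (F.card : ℝ≥0∞) * (2 * volume X)
        ≤ F.card * (2 * ∑ v ∈ F, volume (X ∩ Metric.ball v r)) := by gcongr
      _ = ∑ v ∈ F, (2 * F.card : ℕ) * volume (X ∩ Metric.ball v r) := by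
        rw [← mul_assoc, Finset.mul_sum]
        refine Finset.sum_congr rfl fun v _ => ?_
        push_cast
        ring
      _ ≤ ∑ v ∈ F, volume ((S' : Set (EucSp n ≃ᵢ EucSp n)) • X ∩ B) := Finset.sum_le_sum hstep
      _ = _ := by rw [Finset.sum_const, nsmul_eq_mul]

end LocalExpansion

section Matching

open scoped ENNReal

/-- If increasing sequences of a reflexive transitive relation are bounded above, then a
nonnegative antitone function is eventually stationary. -/
theorem exists_forall_rel_eq_of_antitone {X : Type*} {r : X → X → Prop} (hrefl : ∀ x, r x x)
    (htrans : ∀ x y z, r x y → r y z → r x z) {f : X → ℝ} (hf : ∀ x y, r x y → f y ≤ f x)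
    (h0 : ∀ x, 0 ≤ f x)
    (hseq : ∀ s : ℕ → X, (∀ n, r (s n) (s (n + 1))) → ∃ y, ∀ n, r (s n) y) (x₀ : X) :
    ∃ x, ∀ y, r x y → f y = f x := by
  have hbdd : ∀ x, BddBelow (f '' {y | r x y}) := fun x =>
    ⟨0, by rintro _ ⟨y, -, rfl⟩; exact h0 y⟩
  have hstep : ∀ (n : ℕ) (x : X), ∃ y, r x y ∧ f y < sInf (f '' {y | r x y}) + 1 / (n + 1) := by
    intro n x
    have hne : (f '' {y | r x y}).Nonempty := ⟨f x, x, hrefl x, rfl⟩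
    obtain ⟨_, ⟨y, hy, rfl⟩, hlt⟩ := exists_lt_of_csInf_lt hne
      (lt_add_of_pos_right _ (by positivity : (0 : ℝ) < 1 / (n + 1)))
    exact ⟨y, hy, hlt⟩
  choose F hF hFlt using hstep
  let s : ℕ → X := fun n => Nat.rec x₀ (fun n x => F n x) n
  obtain ⟨x, hx⟩ := hseq s fun n => hF n (s n)
  refine ⟨x, fun y hy => le_antisymm (hf _ _ hy) (le_of_forall_pos_lt_add fun ε hε => ?_)⟩
  obtain ⟨n, hn⟩ := exists_nat_one_div_lt hε
  calc f x ≤ f (s (n + 1)) := hf _ _ (hx (n + 1))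
    _ < sInf (f '' {y | r (s n) y}) + 1 / (n + 1) := hFlt n (s n)
    _ ≤ f y + 1 / (n + 1) := by
      gcongr
      exact csInf_le (hbdd _) ⟨y, htrans _ _ _ (hx n) hy, rfl⟩
    _ < f y + ε := by gcongr

variable {G α ι : Type*} [Group G] [MulAction G α] [MeasurableSpace α]

/-- The sets `P i` are the domains, along `γ i`, of a measurable partial matching from `A`
to `B`. -/
structure IsMatching (γ : ι → G) (A B : Set α) (P : ι → Set α) : Prop where
  measurableSet (i) : MeasurableSet (P i)
  disjoint (i j) : i ≠ j → Disjoint (P i) (P j)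
  subset (i) : P i ⊆ A
  disjoint_smul (i j) : i ≠ j → Disjoint (γ i • P i) (γ j • P j)
  smul_subset (i) : γ i • P i ⊆ B

/-- The part of `A` not covered by a family of sets. -/
def defect (μ : Measure α) (A : Set α) (P : ι → Set α) : ℝ := μ.real (A \ ⋃ i, P i)

theorem defect_nonneg (μ : Measure α) (A : Set α) (P : ι → Set α) : 0 ≤ defect μ A P :=
  measureReal_nonneg

/-- The pointwise lower limit of a sequence of matchings is a matching. -/
theorem IsMatching.liminf {γ : ι → G} {A B : Set α} {P : ℕ → ι → Set α}
    (hP : ∀ n, IsMatching γ A B (P n)) :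
    IsMatching γ A B (fun i => ⋃ n, ⋂ m, P (n + m) i) := by
  have hsub : ∀ i, ∀ x ∈ ⋃ n, ⋂ m, P (n + m) i, ∃ n, ∀ m, n ≤ m → x ∈ P m i := fun i x hx => by
    obtain ⟨n, hn⟩ := mem_iUnion.1 hx
    refine ⟨n, fun m hm => ?_⟩
    obtain ⟨k, rfl⟩ := Nat.exists_eq_add_of_le hm
    exact mem_iInter.1 hn k
  refine ⟨fun i => .iUnion fun n => .iInter fun m => (hP _).measurableSet i, fun i j hij => ?_,
    fun i x hx => ?_, fun i j hij => ?_, fun i => ?_⟩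
  · refine Set.disjoint_left.2 fun x hx hy => ?_
    obtain ⟨n, hn⟩ := hsub i x hx
    obtain ⟨m, hm⟩ := hsub j x hy
    exact Set.disjoint_left.1 ((hP (max n m)).disjoint i j hij) (hn _ (le_max_left _ _))
      (hm _ (le_max_right _ _))
  · obtain ⟨n, hn⟩ := hsub i x hx
    exact (hP n).subset i (hn n le_rfl)
  · refine Set.disjoint_left.2 ?_
    rintro _ ⟨x, hx, rfl⟩ ⟨y, hy, hxy⟩
    obtain ⟨n, hn⟩ := hsub i x hx
    obtain ⟨m, hm⟩ := hsub j y hy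
    exact Set.disjoint_left.1 ((hP (max n m)).disjoint_smul i j hij)
      ⟨x, hn _ (le_max_left _ _), rfl⟩ ⟨y, hm _ (le_max_right _ _), hxy⟩
  · rintro _ ⟨x, hx, rfl⟩
    obtain ⟨n, hn⟩ := hsub i x hx
    exact (hP n).smul_subset i ⟨x, hn n le_rfl, rfl⟩

variable [Fintype ι]

/-- The total measure of the symmetric differences of two families of sets. -/
def familyDist (μ : Measure α) (P Q : ι → Set α) : ℝ≥0∞ := ∑ i, μ (symmDiff (P i) (Q i))

theorem familyDist_self (μ : Measure α) (P : ι → Set α) : familyDist μ P P = 0 := by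
  simp [familyDist]

theorem familyDist_comm (μ : Measure α) (P Q : ι → Set α) :
    familyDist μ P Q = familyDist μ Q P := by
  simp [familyDist, symmDiff_comm]

theorem familyDist_triangle (μ : Measure α) (P Q R : ι → Set α) :
    familyDist μ P R ≤ familyDist μ P Q + familyDist μ Q R := by
  rw [familyDist, familyDist, familyDist, ← Finset.sum_add_distrib]
  exact Finset.sum_le_sum fun i _ => measure_symmDiff_le _ _ _

theorem ofReal_defect_le {μ : Measure α} {A : Set α} (hA : μ A ≠ ⊤) (P Q : ι → Set α) :
    ENNReal.ofReal (defect μ A P) ≤ ENNReal.ofReal (defect μ A Q) + familyDist μ P Q := by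
  have hfin : ∀ R : ι → Set α, μ (A \ ⋃ i, R i) ≠ ⊤ := fun R =>
    ne_top_of_le_ne_top hA (measure_mono sdiff_subset)
  simp only [defect, ofReal_measureReal (hfin _)]
  calc μ (A \ ⋃ i, P i) ≤ μ ((A \ ⋃ i, Q i) ∪ ⋃ i, symmDiff (P i) (Q i)) := by
        refine measure_mono fun x hx => ?_
        by_cases h : x ∈ ⋃ i, Q i
        · obtain ⟨i, hi⟩ := mem_iUnion.1 h
          exact Or.inr (mem_iUnion.2 ⟨i, Or.inr ⟨hi, fun h' => hx.2 (mem_iUnion.2 ⟨i, h'⟩)⟩⟩)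
        · exact Or.inl ⟨hx.1, h⟩
    _ ≤ _ := (measure_union_le _ _).trans (add_le_add_right (by
        simpa [familyDist] using measure_iUnion_fintype_le μ fun i => symmDiff (P i) (Q i)) _)

theorem familyDist_liminf_le (μ : Measure α) (P : ℕ → ι → Set α) (n : ℕ) :
    familyDist μ (P n) (fun i => ⋃ n, ⋂ m, P (n + m) i)
      ≤ ∑' m, familyDist μ (P (n + m)) (P (n + m + 1)) := by
  simp only [familyDist]
  rw [Summable.tsum_finsetSum fun i _ => ENNReal.summable]
  refine Finset.sum_le_sum fun i _ => le_trans (measure_mono fun x hx => ?_) (measure_iUnion_le _)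
  by_contra hcon
  have h1 : ∀ m, x ∈ P (n + m) i ↔ x ∈ P (n + m + 1) i := fun m => by
    have := fun h => hcon (mem_iUnion.2 ⟨m, h⟩)
    rw [mem_symmDiff] at this
    tauto
  have h2 : ∀ m, x ∈ P (n + m) i ↔ x ∈ P n i := fun m => by
    induction m with
    | zero => rfl
    | succ m ih => rw [← ih, h1 m]; rfl
  rcases hx with ⟨hx, hx'⟩ | ⟨hx, hx'⟩
  · exact hx' (mem_iUnion.2 ⟨n, mem_iInter.2 fun m => (h2 m).2 hx⟩)
  · obtain ⟨k, hk⟩ := mem_iUnion.1 hx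
    refine hx' ((h2 k).1 ?_)
    rw [add_comm]
    exact mem_iInter.1 hk n

/-- If every matching with positive defect can be improved at a controlled cost, then there
is a matching with zero defect. -/
theorem exists_isMatching_defect_eq_zero {γ : ι → G} {A B : Set α} {μ : Measure α}
    (hA : μ A ≠ ⊤) (K : ℝ) (hK : 0 ≤ K)
    (himp : ∀ P, IsMatching γ A B P → 0 < defect μ A P → ∃ Q, IsMatching γ A B Q ∧
      defect μ A Q < defect μ A P ∧
      familyDist μ P Q ≤ ENNReal.ofReal (K * (√(defect μ A P) - √(defect μ A Q)))) :
    ∃ P, IsMatching γ A B P ∧ defect μ A P = 0 := by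
  let X := {P : ι → Set α // IsMatching γ A B P}
  let f : X → ℝ := fun P => √(defect μ A P.1)
  let r : X → X → Prop := fun P Q =>
    f Q ≤ f P ∧ familyDist μ P.1 Q.1 ≤ ENNReal.ofReal (K * (f P - f Q))
  have htrans : ∀ P Q R : X, r P Q → r Q R → r P R := fun P Q R h₁ h₂ => by
    refine ⟨h₂.1.trans h₁.1, (familyDist_triangle μ P.1 Q.1 R.1).trans
      ((add_le_add h₁.2 h₂.2).trans (le_of_eq ?_))⟩
    rw [← ENNReal.ofReal_add (mul_nonneg hK (sub_nonneg.2 h₁.1))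
      (mul_nonneg hK (sub_nonneg.2 h₂.1))]
    congr 1
    ring
  have hseq : ∀ s : ℕ → X, (∀ n, r (s n) (s (n + 1))) → ∃ y, ∀ n, r (s n) y := by
    intro s hs
    have hfs : Antitone (f ∘ s) := antitone_nat_of_succ_le fun n => (hs n).1
    have hbdd : BddBelow (range (f ∘ s)) :=
      ⟨0, by rintro _ ⟨n, rfl⟩; exact Real.sqrt_nonneg _⟩
    set l := ⨅ n, (f ∘ s) n
    have hlim : Filter.Tendsto (f ∘ s) Filter.atTop (nhds l) := tendsto_atTop_ciInf hfs hbdd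
    have hl : ∀ n, l ≤ f (s n) := fun n => ciInf_le hbdd n
    let Y : X := ⟨_, IsMatching.liminf fun n => (s n).2⟩
    have hd : ∀ n, familyDist μ (s n).1 Y.1 ≤ ENNReal.ofReal (K * (f (s n) - l)) := by
      intro n
      refine (familyDist_liminf_le μ (fun n => (s n).1) n).trans
        (ENNReal.tsum_le_of_sum_range_le fun N => ?_)
      have h1 : ∑ m ∈ Finset.range N, familyDist μ (s (n + m)).1 (s (n + m + 1)).1
          ≤ ENNReal.ofReal (K * (f (s n) - f (s (n + N)))) := by
        induction N with
        | zero => simp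
        | succ N ih =>
          rw [Finset.sum_range_succ]
          refine (add_le_add ih (hs (n + N)).2).trans (le_of_eq ?_)
          have hnN : f (s (n + N)) ≤ f (s n) := hfs (Nat.le_add_right n N)
          rw [← ENNReal.ofReal_add (mul_nonneg hK (sub_nonneg.2 hnN))
            (mul_nonneg hK (sub_nonneg.2 (hs (n + N)).1))]
          congr 1
          rw [← add_assoc]
          ring
      refine h1.trans (ENNReal.ofReal_le_ofReal ?_)
      gcongr
      exact hl _
    have hYl : f Y = l := by
      have hd0 : Filter.Tendsto (fun n => ENNReal.ofReal (K * (f (s n) - l))) Filter.atTop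
          (nhds 0) := by
        rw [← ENNReal.ofReal_zero, show (0 : ℝ) = K * (l - l) by ring]
        exact ENNReal.tendsto_ofReal ((hlim.sub_const l).const_mul K)
      have hu : Filter.Tendsto (fun n => ENNReal.ofReal (defect μ A (s n).1)) Filter.atTop
          (nhds (ENNReal.ofReal (l ^ 2))) := by
        refine ENNReal.tendsto_ofReal ((hlim.pow 2).congr fun n => ?_)
        exact Real.sq_sqrt (defect_nonneg _ _ _)
      have h1 : ENNReal.ofReal (defect μ A Y.1) ≤ ENNReal.ofReal (l ^ 2) := by
        have := hu.add hd0
        rw [add_zero] at this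
        refine ge_of_tendsto' this fun n => (ofReal_defect_le hA Y.1 (s n).1).trans ?_
        gcongr
        rw [familyDist_comm]
        exact hd n
      have h2 : ENNReal.ofReal (l ^ 2) ≤ ENNReal.ofReal (defect μ A Y.1) := by
        have := (tendsto_const_nhds (x := ENNReal.ofReal (defect μ A Y.1))).add hd0
        rw [add_zero] at this
        refine le_of_tendsto_of_tendsto' hu this fun n => (ofReal_defect_le hA (s n).1 Y.1).trans ?_
        gcongr
        exact hd n
      have h3 : defect μ A Y.1 = l ^ 2 :=
        (ENNReal.ofReal_eq_ofReal_iff (defect_nonneg _ _ _) (sq_nonneg _)).1 (h1.antisymm h2)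
      change √(defect μ A Y.1) = l
      rw [h3]
      exact Real.sqrt_sq (le_ciInf fun n => Real.sqrt_nonneg _)
    exact ⟨Y, fun n => ⟨hYl.trans_le (hl n), hYl ▸ hd n⟩⟩
  obtain ⟨P, hP⟩ := exists_forall_rel_eq_of_antitone
    (fun P => (⟨le_rfl, by simp [familyDist_self]⟩ : r P P)) htrans (fun _ _ h => h.1)
    (fun _ => Real.sqrt_nonneg _) hseq ⟨fun _ => ∅, by constructor <;> simp⟩
  refine ⟨P.1, P.2, ?_⟩
  by_contra hne
  obtain ⟨Q, hQ, hlt, hd⟩ := himp P.1 P.2 ((defect_nonneg _ _ _).lt_of_ne' hne)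
  have hlt' := Real.sqrt_lt_sqrt (defect_nonneg _ _ _) hlt
  exact hlt'.ne (hP ⟨Q, hQ⟩ ⟨hlt'.le, hd⟩)

end Matching

section Reach

open scoped ENNReal

theorem two_pow_mul_le_of_expansion {a u : ℝ} {x y : ℕ → ℝ} {J : ℕ} (hu : 0 ≤ u)
    (hx0 : x 0 = u) (hx : ∀ j, x j ≤ a)
    (hxy : ∀ j, 2 * x j ≤ y j ∨ 3 * (a - y j) ≤ a)
    (hyx : ∀ j, 2 * (a - y j) ≤ a - x j ∨ 3 * x j ≤ a)
    (hstep : ∀ j ≤ 2 * J, u + y j ≤ x (j + 1)) : 2 ^ J * u ≤ a := by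
  rcases hu.eq_or_lt with rfl | hu
  · simpa [hx0] using hx 0
  have ha : 0 < a := hu.trans_le (hx0 ▸ hx 0)
  have hfirst : ∀ j ≤ J, 2 ^ j * u ≤ x j ∨ ∃ i < j, 3 * (a - y i) ≤ a := by
    intro j
    induction j with
    | zero => simp [hx0]
    | succ j ih =>
      intro hj
      rcases ih (by omega) with h | ⟨i, hi, h⟩
      · rcases hxy j with h' | h'
        · left
          have := hstep j (by omega)
          rw [pow_succ]
          linarith
        · exact Or.inr ⟨j, j.lt_succ_self, h'⟩
      · exact Or.inr ⟨i, by omega, h⟩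
  rcases hfirst J le_rfl with h | ⟨i, hi, h⟩
  · exact h.trans (hx J)
  have hsecond : ∀ l ≤ J, 2 * a ≤ 3 * x (i + 1 + l) ∧ 2 ^ l * (a - x (i + 1 + l)) ≤ a := by
    intro l
    induction l with
    | zero =>
      intro _
      have := hstep i (by omega)
      simp only [add_zero, pow_zero, one_mul]
      constructor <;> linarith
    | succ l ih =>
      intro hl
      obtain ⟨h1, h2⟩ := ih (by omega)
      have h3 := (hyx (i + 1 + l)).resolve_right (by linarith)
      have h4 := hstep (i + 1 + l) (by omega)
      rw [← add_assoc]
      refine ⟨by linarith, le_trans ?_ h2⟩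
      rw [pow_succ, mul_assoc]
      gcongr
      linarith
  obtain ⟨h1, h2⟩ := hsecond J le_rfl
  have h3 := (hyx (i + 1 + J)).resolve_right (by linarith)
  have h4 := hstep (i + 1 + J) (by omega)
  have h5 := hx (i + 1 + J + 1)
  refine le_trans ?_ h2
  gcongr
  linarith

variable {G α ι : Type*} [Group G] [MulAction G α]

/-- The set of neighbours in `B` of points of `X`, along the moves `γ`. -/
def neighbours (γ : ι → G) (B X : Set α) : Set α := ⋃ i, γ i • X ∩ B

/-- The points of `A` reachable from an unmatched point by an alternating path with at most `j`
matched edges. -/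
def reach (γ : ι → G) (A B : Set α) (P : ι → Set α) : ℕ → Set α
  | 0 => A \ ⋃ i, P i
  | j + 1 => reach γ A B P j ∪ ⋃ i, P i ∩ (γ i)⁻¹ • neighbours γ B (reach γ A B P j)

theorem neighbours_subset (γ : ι → G) (B X : Set α) : neighbours γ B X ⊆ B :=
  iUnion_subset fun _ => inter_subset_right

theorem diff_subset_reach (γ : ι → G) (A B : Set α) (P : ι → Set α) (j : ℕ) :
    A \ ⋃ i, P i ⊆ reach γ A B P j := by
  induction j with
  | zero => exact subset_rfl
  | succ j ih => exact ih.trans subset_union_left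

variable [MeasurableSpace α] {γ : ι → G} {A B : Set α} {P : ι → Set α} {μ : Measure α}

theorem IsMatching.reach_subset (hP : IsMatching γ A B P) (j : ℕ) : reach γ A B P j ⊆ A := by
  induction j with
  | zero => exact sdiff_subset
  | succ j ih =>
    exact union_subset ih (iUnion_subset fun i => inter_subset_left.trans (hP.subset i))

variable [MeasurableConstSMul G α] [Fintype ι]

theorem measurableSet_neighbours (γ : ι → G) (hB : MeasurableSet B) {X : Set α}
    (hX : MeasurableSet X) : MeasurableSet (neighbours γ B X) :=
  .iUnion fun i => (hX.const_smul (γ i)).inter hB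

theorem IsMatching.measurableSet_reach (hP : IsMatching γ A B P) (hA : MeasurableSet A)
    (hB : MeasurableSet B) (j : ℕ) : MeasurableSet (reach γ A B P j) := by
  induction j with
  | zero => exact hA.diff (.iUnion hP.measurableSet)
  | succ j ih =>
    exact ih.union (.iUnion fun i => (hP.measurableSet i).inter
      ((measurableSet_neighbours γ hB ih).const_smul _))

variable [SMulInvariantMeasure G α μ]

theorem IsMatching.measure_add_le_reach_succ (hP : IsMatching γ A B P) (hA : MeasurableSet A)
    (hB : MeasurableSet B) {j : ℕ}
    (hnull : μ (neighbours γ B (reach γ A B P j) \ ⋃ i, γ i • P i) = 0) :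
    μ (A \ ⋃ i, P i) + μ (neighbours γ B (reach γ A B P j)) ≤ μ (reach γ A B P (j + 1)) := by
  set R := neighbours γ B (reach γ A B P j)
  have hR : MeasurableSet R := measurableSet_neighbours γ hB (hP.measurableSet_reach hA hB j)
  have hPm : ∀ i, MeasurableSet (P i ∩ (γ i)⁻¹ • R) := fun i =>
    (hP.measurableSet i).inter (hR.const_smul _)
  have h1 : μ R ≤ ∑ i, μ (P i ∩ (γ i)⁻¹ • R) := by
    calc μ R ≤ μ ((R \ ⋃ i, γ i • P i) ∪ ⋃ i, γ i • (P i ∩ (γ i)⁻¹ • R)) := by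
          refine measure_mono fun x hx => ?_
          by_cases h : x ∈ ⋃ i, γ i • P i
          · obtain ⟨i, hi⟩ := mem_iUnion.1 h
            refine Or.inr (mem_iUnion.2 ⟨i, ?_⟩)
            rw [smul_set_inter, smul_inv_smul]
            exact ⟨hi, hx⟩
          · exact Or.inl ⟨hx, h⟩
      _ ≤ 0 + ∑ i, μ (γ i • (P i ∩ (γ i)⁻¹ • R)) :=
          (measure_union_le _ _).trans (add_le_add hnull.le (measure_iUnion_fintype_le μ _))
      _ = _ := by simp only [zero_add, measure_smul]
  calc μ (A \ ⋃ i, P i) + μ R ≤ μ (A \ ⋃ i, P i) + ∑ i, μ (P i ∩ (γ i)⁻¹ • R) := by gcongr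
    _ = μ (A \ ⋃ i, P i) + μ (⋃ i, P i ∩ (γ i)⁻¹ • R) := by
      rw [measure_iUnion (fun i k hik => ((hP.disjoint i k hik).mono inter_subset_left
        inter_subset_left)) hPm, tsum_fintype]
    _ = μ ((A \ ⋃ i, P i) ∪ ⋃ i, P i ∩ (γ i)⁻¹ • R) := by
      refine (measure_union ?_ (.iUnion hPm)).symm
      exact disjoint_sdiff_left.mono_right (iUnion_mono fun i => inter_subset_left)
    _ ≤ _ := measure_mono (union_subset_union_left _ (diff_subset_reach γ A B P j))

/-- If there are few augmenting paths of length up to `2 * J`, the defect is exponentially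
small in `J`. -/
theorem IsMatching.two_pow_mul_defect_le (hP : IsMatching γ A B P) (hA : MeasurableSet A)
    (hB : MeasurableSet B) (hfin : μ A ≠ ⊤) (hμ : μ A = μ B)
    (hAB : ∀ X ⊆ A, MeasurableSet X → 2 * μ X ≤ μ (neighbours γ B X) ∨
      3 * μ (B \ neighbours γ B X) ≤ μ B)
    (hBA : ∀ Y ⊆ B, MeasurableSet Y → 2 * μ Y ≤ μ (neighbours (fun i => (γ i)⁻¹) A Y) ∨
      3 * μ (A \ neighbours (fun i => (γ i)⁻¹) A Y) ≤ μ A) {J : ℕ}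
    (hnull : ∀ j ≤ 2 * J, μ (neighbours γ B (reach γ A B P j) \ ⋃ i, γ i • P i) = 0) :
    2 ^ J * defect μ A P ≤ μ.real A := by
  set X := reach γ A B P
  set R : ℕ → Set α := fun j => neighbours γ B (X j)
  have hXA : ∀ j, X j ⊆ A := hP.reach_subset
  have hXm : ∀ j, MeasurableSet (X j) := hP.measurableSet_reach hA hB
  have hRm : ∀ j, MeasurableSet (R j) := fun j => measurableSet_neighbours γ hB (hXm j)
  have hRB : ∀ j, R j ⊆ B := fun j => neighbours_subset _ _ _
  have hfinB : μ B ≠ ⊤ := hμ ▸ hfin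
  have hreal : μ.real A = μ.real B := by rw [measureReal_def, hμ, measureReal_def]
  have hreal_le : ∀ {c d : ℕ} {E F : Set α}, μ F ≠ ⊤ → (c : ℝ≥0∞) * μ E ≤ d * μ F →
      c * μ.real E ≤ d * μ.real F := by
    intro c d E F hF h
    have := ENNReal.toReal_mono (by finiteness) h
    simpa [measureReal_def] using this
  have hfA : ∀ {E}, E ⊆ A → μ E ≠ ⊤ := fun h => ne_top_of_le_ne_top hfin (measure_mono h)
  have hfB : ∀ {E}, E ⊆ B → μ E ≠ ⊤ := fun h => ne_top_of_le_ne_top hfinB (measure_mono h)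
  have hdR : ∀ j, μ.real (B \ R j) = μ.real A - μ.real (R j) := fun j => by
    rw [hreal, measureReal_sdiff (hRB j) (hRm j) hfinB]
  have hdX : ∀ j, μ.real (A \ X j) = μ.real A - μ.real (X j) := fun j => by
    rw [measureReal_sdiff (hXA j) (hXm j) hfin]
  refine two_pow_mul_le_of_expansion (x := fun j => μ.real (X j)) (y := fun j => μ.real (R j))
    (defect_nonneg _ _ _) rfl (fun j => measureReal_mono (hXA j) hfin)
    (fun j => ?_) (fun j => ?_) (fun j hj => ?_)
  · rw [← hdR, hreal]
    refine (hAB (X j) (hXA j) (hXm j)).imp (fun h => ?_) fun h => ?_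
    · simpa using hreal_le (c := 2) (d := 1) (hfB (hRB j)) (by simpa using h)
    · simpa using hreal_le (c := 3) (d := 1) hfinB (by simpa using h)
  · rw [← hdR, ← hdX]
    have hsub : neighbours (fun i => (γ i)⁻¹) A (B \ R j) ⊆ A \ X j := by
      refine iUnion_subset fun i x hx => ⟨hx.2, fun hxX => ?_⟩
      have hx' := mem_smul_set_iff_inv_smul_mem.1 hx.1
      rw [inv_inv] at hx'
      exact hx'.2 (mem_iUnion.2 ⟨i, smul_mem_smul_set hxX, hx'.1⟩)
    refine (hBA (B \ R j) sdiff_subset (hB.diff (hRm j))).imp (fun h => ?_) fun h => ?_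
    · simpa using hreal_le (c := 2) (d := 1) (hfA sdiff_subset)
        (by simpa using h.trans (measure_mono hsub))
    · have hsup : X j ⊆ A \ neighbours (fun i => (γ i)⁻¹) A (B \ R j) :=
        fun x hx => ⟨hXA j hx, fun hx' => (hsub hx').2 hx⟩
      refine (mul_le_mul_of_nonneg_left (measureReal_mono hsup (hfA sdiff_subset))
        (by norm_num : (0 : ℝ) ≤ 3)).trans ?_
      simpa using hreal_le (c := 3) (d := 1) hfin (by simpa using h)
  · have := ENNReal.toReal_mono (hfA (hXA (j + 1)))
      (hP.measure_add_le_reach_succ hA hB (hnull j hj))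
    rwa [ENNReal.toReal_add (hfA sdiff_subset) (hfB (hRB j))] at this

end Reach

section Augmenting

open scoped ENNReal

variable {G α ι : Type*} [Group G] [MulAction G α]

/-- The group element leading from the start of an alternating path with labels `w` to its `k`-th
vertex in `A`. -/
def walkElt (γ : ι → G) (w : ℕ → ι × ι) : ℕ → G
  | 0 => 1
  | k + 1 => (γ (w k).2)⁻¹ * γ (w k).1 * walkElt γ w k

/-- The starting points of augmenting paths with `k` matched edges and labels `w`. -/
def augmenting (γ : ι → G) (A B : Set α) (P : ι → Set α) (w : ℕ → ι × ι) (k : ℕ) : Set α :=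
  {x | x ∈ A \ ⋃ i, P i ∧ (∀ i < k, walkElt γ w (i + 1) • x ∈ P (w i).2) ∧
    γ (w k).1 • walkElt γ w k • x ∈ B \ ⋃ i, γ i • P i}

theorem walkElt_congr (γ : ι → G) {w w' : ℕ → ι × ι} {k : ℕ} (h : ∀ i < k, w i = w' i) :
    walkElt γ w k = walkElt γ w' k := by
  induction k with
  | zero => rfl
  | succ k ih => rw [walkElt, walkElt, h k k.lt_succ_self, ih fun i hi => h i (by omega)]

theorem smul_walkElt_succ (γ : ι → G) (w : ℕ → ι × ι) (k : ℕ) (x : α) :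
    γ (w k).2 • walkElt γ w (k + 1) • x = γ (w k).1 • walkElt γ w k • x := by
  rw [walkElt, ← mul_smul, ← mul_smul, mul_assoc, mul_inv_cancel_left]

theorem augmenting_congr {γ : ι → G} {A B : Set α} {P : ι → Set α} {w w' : ℕ → ι × ι} {k : ℕ}
    (h : ∀ i ≤ k, w i = w' i) : augmenting γ A B P w k = augmenting γ A B P w' k := by
  ext x
  have h1 : ∀ i ≤ k, walkElt γ w i = walkElt γ w' i := fun i hi =>
    walkElt_congr γ fun l hl => h l (by omega)
  simp only [augmenting, mem_ofPred_eq]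
  rw [h1 k le_rfl, h k le_rfl]
  refine and_congr_right fun _ => and_congr_left fun _ => forall₂_congr fun i hi => ?_
  rw [h1 (i + 1) hi, h i hi.le]

theorem exists_walk_of_mem_reach {γ : ι → G} {A B : Set α} {P : ι → Set α} [Nonempty ι] {j : ℕ}
    {x : α} (hx : x ∈ reach γ A B P j) :
    ∃ k ≤ j, ∃ (w : ℕ → ι × ι) (y : α), y ∈ A \ ⋃ i, P i ∧
      (∀ i < k, walkElt γ w (i + 1) • y ∈ P (w i).2) ∧ walkElt γ w k • y = x := by
  induction j generalizing x with
  | zero =>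
    obtain ⟨i⟩ := ‹Nonempty ι›
    exact ⟨0, le_rfl, fun _ => (i, i), x, hx, by simp, one_smul _ _⟩
  | succ j ih =>
    rcases hx with hx | hx
    · obtain ⟨k, hk, h⟩ := ih hx
      exact ⟨k, by omega, h⟩
    · obtain ⟨p, hxp, hx⟩ := mem_iUnion.1 hx
      obtain ⟨q, ⟨z, hz, hzq⟩, -⟩ := mem_iUnion.1 (mem_inv_smul_set_iff.1 hx)
      obtain ⟨k, hk, w, y, hy, hw, rfl⟩ := ih hz
      have hc : ∀ i ≤ k, walkElt γ (Function.update w k (q, p)) i = walkElt γ w i := fun i hi =>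
        walkElt_congr γ fun l hl => Function.update_of_ne (by omega) _ _
      have hlast : walkElt γ (Function.update w k (q, p)) (k + 1) • y = x := by
        rw [walkElt, Function.update_self, hc k le_rfl, mul_smul, mul_smul]
        exact inv_smul_eq_iff.2 hzq
      refine ⟨k + 1, by omega, Function.update w k (q, p), y, hy, fun i hi => ?_, hlast⟩
      rcases (Nat.lt_succ_iff.1 hi).lt_or_eq with hi | rfl
      · rw [hc _ hi, Function.update_of_ne hi.ne]
        exact hw i hi
      · rw [hlast, Function.update_self]
        exact hxp

/-- A nonempty alternating cycle in an augmenting path can be cut out. -/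
theorem mem_augmenting_shortcut {γ : ι → G} {A B : Set α} {P : ι → Set α} {w : ℕ → ι × ι}
    {k i d : ℕ} (hid : i + d ≤ k) {x : α}
    (hx : x ∈ augmenting γ A B P w k) (he : walkElt γ w i • x = walkElt γ w (i + d) • x) :
    x ∈ augmenting γ A B P (fun l => if l < i then w l else w (l + d)) (k - d) := by
  set w' : ℕ → ι × ι := fun l => if l < i then w l else w (l + d)
  have hlt : ∀ l < i, w' l = w l := fun l hl => if_pos hl
  have hge : ∀ l, i ≤ l → w' l = w (l + d) := fun l hl => if_neg (not_lt.2 hl)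
  have h1 : ∀ l ≤ i, walkElt γ w' l = walkElt γ w l := fun l hl =>
    walkElt_congr γ fun m hm => hlt m (by omega)
  have h2 : ∀ l, i ≤ l → walkElt γ w' l • x = walkElt γ w (l + d) • x := by
    intro l hl
    induction l, hl using Nat.le_induction with
    | base => rw [h1 i le_rfl, he]
    | succ l hl ih =>
      rw [show l + 1 + d = l + d + 1 by ring, walkElt, walkElt, mul_smul, mul_smul _ _ x, ih,
        hge l hl]
  obtain ⟨hx0, hx1, hx2⟩ := hx
  refine ⟨hx0, fun l hl => ?_, ?_⟩
  · rcases lt_or_ge l i with h | h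
    · rw [h1 _ h, hlt l h]
      exact hx1 l (by omega)
    · rw [h2 _ (by omega), hge l h, show l + 1 + d = l + d + 1 by ring]
      exact hx1 (l + d) (by omega)
  · rw [h2 _ (by omega), hge _ (by omega), Nat.sub_add_cancel (by omega)]
    exact hx2

variable [MeasurableSpace α] [Fintype ι] {γ : ι → G} {A B : Set α} {P : ι → Set α} {μ : Measure α}
  [SMulInvariantMeasure G α μ]

theorem measure_neighbours_reach_diff_eq_zero [Nonempty ι] {j : ℕ}
    (h : ∀ k ≤ j, ∀ w, μ (augmenting γ A B P w k) = 0) :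
    μ (neighbours γ B (reach γ A B P j) \ ⋃ i, γ i • P i) = 0 := by
  let ext (k : ℕ) (v : Fin (k + 1) → ι × ι) : ℕ → ι × ι := fun i => v (Fin.ofNat (k + 1) i)
  have hext : ∀ k (w : ℕ → ι × ι), ∀ i ≤ k, ext k (fun l => w l) i = w i := fun k w i hi => by
    simp only [ext, Fin.val_ofNat]
    rw [Nat.mod_eq_of_lt (by omega)]
  refine measure_mono_null (t := ⋃ k, ⋃ _ : k ≤ j, ⋃ v : Fin (k + 1) → ι × ι,
    (γ (ext k v k).1 * walkElt γ (ext k v) k) • augmenting γ A B P (ext k v) k) ?_ ?_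
  · rintro y ⟨hy, hyB⟩
    obtain ⟨q, ⟨x, hx, rfl⟩, hqB⟩ := mem_iUnion.1 hy
    obtain ⟨k, hk, w, z, hz, hw, rfl⟩ := exists_walk_of_mem_reach hx
    set w' := Function.update w k (q, q)
    have hc : ∀ i ≤ k, walkElt γ w' i = walkElt γ w i := fun i hi =>
      walkElt_congr γ fun l hl => Function.update_of_ne (by omega) _ _
    have hend : γ (w' k).1 • walkElt γ w' k • z = γ q • walkElt γ w k • z := by
      rw [hc k le_rfl]
      simp [w']
    have hmem : z ∈ augmenting γ A B P w' k := by
      refine ⟨hz, fun i hi => ?_, ?_⟩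
      · rw [hc _ hi, show w' i = w i from Function.update_of_ne hi.ne _ _]
        exact hw i hi
      · rw [hend]
        exact ⟨hqB, hyB⟩
    refine mem_iUnion.2 ⟨k, mem_iUnion.2 ⟨hk, mem_iUnion.2 ⟨fun l => w' l, ?_⟩⟩⟩
    rw [augmenting_congr (hext k w'), hext k w' k le_rfl,
      walkElt_congr γ fun i hi => hext k w' i hi.le]
    refine ⟨z, hmem, ?_⟩
    change (γ (w' k).1 * walkElt γ w' k) • z = _
    rw [mul_smul]
    exact hend
  · simp only [measure_iUnion_null_iff, measure_smul]
    exact fun k hk v => h k hk _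

variable [MeasurableConstSMul G α]

theorem IsMatching.measurableSet_augmenting (hP : IsMatching γ A B P) (hA : MeasurableSet A)
    (hB : MeasurableSet B) (w : ℕ → ι × ι) (k : ℕ) : MeasurableSet (augmenting γ A B P w k) := by
  have h1 : MeasurableSet (A \ ⋃ i, P i) := hA.diff (.iUnion hP.measurableSet)
  have h2 : MeasurableSet (B \ ⋃ i, γ i • P i) :=
    hB.diff (.iUnion fun i => (hP.measurableSet i).const_smul _)
  refine h1.inter (MeasurableSet.inter (s₁ := {x | ∀ i < k, walkElt γ w (i + 1) • x ∈ P (w i).2})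
    ?_ ?_)
  · have : {x | ∀ i < k, walkElt γ w (i + 1) • x ∈ P (w i).2}
        = ⋂ i, ⋂ _ : i < k, (walkElt γ w (i + 1) • ·) ⁻¹' P (w i).2 := by
      ext x
      simp
    rw [this]
    exact .iInter fun i => .iInter fun _ => measurable_const_smul _ (hP.measurableSet _)
  · exact measurable_const_smul _ (measurable_const_smul _ h2)

/-- The length of the shortest augmenting paths is controlled by the defect. -/
theorem IsMatching.sq_mul_defect_le [Nonempty ι] (hP : IsMatching γ A B P) (hA : MeasurableSet A)
    (hB : MeasurableSet B) (hfin : μ A ≠ ⊤) (hμ : μ A = μ B)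
    (hAB : ∀ X ⊆ A, MeasurableSet X → 2 * μ X ≤ μ (neighbours γ B X) ∨
      3 * μ (B \ neighbours γ B X) ≤ μ B)
    (hBA : ∀ Y ⊆ B, MeasurableSet Y → 2 * μ Y ≤ μ (neighbours (fun i => (γ i)⁻¹) A Y) ∨
      3 * μ (A \ neighbours (fun i => (γ i)⁻¹) A Y) ≤ μ A) {k : ℕ}
    (hnull : ∀ l < k, ∀ w, μ (augmenting γ A B P w l) = 0) :
    ((k : ℝ) + 1) ^ 2 * defect μ A P ≤ 32 * μ.real A := by
  have hu := defect_nonneg μ A P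
  rcases lt_or_ge k 2 with hk | hk
  · have h1 : defect μ A P ≤ μ.real A := measureReal_mono sdiff_subset hfin
    have h2 : (k : ℝ) + 1 ≤ 2 := by exact_mod_cast (by omega : k + 1 ≤ 2)
    have h3 : ((k : ℝ) + 1) ^ 2 ≤ 4 := by nlinarith [(Nat.cast_nonneg k : (0 : ℝ) ≤ k)]
    nlinarith
  · set J := (k - 2) / 2
    have h1 : 2 ^ J * defect μ A P ≤ μ.real A :=
      hP.two_pow_mul_defect_le hA hB hfin hμ hAB hBA fun j hj =>
        measure_neighbours_reach_diff_eq_zero fun l hl => hnull l (by omega)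
    have h2 : ∀ J : ℕ, (J + 2) ^ 2 ≤ 8 * 2 ^ J := by
      intro J
      induction J with
      | zero => norm_num
      | succ J ih =>
        rw [pow_succ 2]
        rcases J with _ | J
        · norm_num
        · nlinarith [Nat.zero_le (J * J)]
    have h3 : ((k : ℝ) + 1) ^ 2 ≤ 32 * 2 ^ J := by
      have h4 : k + 1 ≤ 2 * (J + 2) := by omega
      have h5 : (k + 1) ^ 2 ≤ 32 * 2 ^ J := by
        calc (k + 1) ^ 2 ≤ (2 * (J + 2)) ^ 2 := Nat.pow_le_pow_left h4 2
          _ = 4 * (J + 2) ^ 2 := by ring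
          _ ≤ 32 * 2 ^ J := by linarith [h2 J]
      exact_mod_cast h5
    nlinarith

end Augmenting

section Flip

open scoped ENNReal

variable {G α ι : Type*} [Group G] [MulAction G α] {γ : ι → G} {A B : Set α} {P : ι → Set α}
  {w : ℕ → ι × ι} {k : ℕ} {Q : Set α}

open Classical in
/-- The family obtained from `P` by flipping the alternating paths with labels `w` and `k` matched
edges, starting from points of `Q`. -/
def flipAlong (γ : ι → G) (P : ι → Set α) (w : ℕ → ι × ι) (k : ℕ) (Q : Set α) (q : ι) : Set α :=
  (P q \ ⋃ i ∈ Finset.range (k + 1), walkElt γ w i • Q) ∪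
    ⋃ i ∈ (Finset.range (k + 1)).filter (fun i => (w i).1 = q), walkElt γ w i • Q

theorem mem_flipAlong {q : ι} {x : α} : x ∈ flipAlong γ P w k Q q ↔
    (x ∈ P q ∧ ∀ i ≤ k, x ∉ walkElt γ w i • Q) ∨ ∃ i ≤ k, (w i).1 = q ∧ x ∈ walkElt γ w i • Q := by
  classical
  simp only [flipAlong, mem_union, mem_sdiff, mem_iUnion, Finset.mem_filter, Finset.mem_range,
    Nat.lt_succ_iff, exists_prop, not_exists, not_and, and_assoc]

theorem walkElt_smul_subset (hQ : Q ⊆ augmenting γ A B P w k) {i : ℕ} (hi : i < k) :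
    walkElt γ w (i + 1) • Q ⊆ P (w i).2 := by
  rintro _ ⟨z, hz, rfl⟩
  exact (hQ hz).2.1 i hi

variable [MeasurableSpace α]

theorem IsMatching.eq_of_smul_eq (hP : IsMatching γ A B P) {p q : ι} {x y : α} (hx : x ∈ P p)
    (hy : y ∈ P q) (h : γ p • x = γ q • y) : p = q ∧ x = y := by
  have hpq : p = q := by
    by_contra hpq
    exact Set.disjoint_left.1 (hP.disjoint_smul p q hpq) (smul_mem_smul_set hx)
      (h ▸ smul_mem_smul_set hy)
  subst hpq
  exact ⟨rfl, smul_left_cancel _ h⟩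

theorem IsMatching.eq_of_target_eq (hP : IsMatching γ A B P) (hQ : Q ⊆ augmenting γ A B P w k)
    (hdisj : ∀ i ≤ k, ∀ j ≤ k, i ≠ j → Disjoint (walkElt γ w i • Q) (walkElt γ w j • Q))
    {i j : ℕ} (hi : i ≤ k) (hj : j ≤ k) {x y : α} (hx : x ∈ Q) (hy : y ∈ Q)
    (h : γ (w i).1 • walkElt γ w i • x = γ (w j).1 • walkElt γ w j • y) : i = j := by
  have hmatched : ∀ {l : ℕ}, l < k → ∀ {z : α}, z ∈ Q →
      γ (w l).1 • walkElt γ w l • z ∈ ⋃ i, γ i • P i := fun {l} hl {z} hz => by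
    rw [← smul_walkElt_succ]
    exact mem_iUnion.2 ⟨_, smul_mem_smul_set ((hQ hz).2.1 l hl)⟩
  rcases hi.lt_or_eq with hi | rfl <;> rcases hj.lt_or_eq with hj | rfl
  · rw [← smul_walkElt_succ, ← smul_walkElt_succ] at h
    have he := (hP.eq_of_smul_eq ((hQ hx).2.1 i hi) ((hQ hy).2.1 j hj) h).2
    by_contra hne
    exact Set.disjoint_left.1 (hdisj (i + 1) hi (j + 1) hj (by omega)) (smul_mem_smul_set hx)
      (he ▸ smul_mem_smul_set hy)
  · exact absurd (h ▸ hmatched hi hx) (hQ hy).2.2.2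
  · exact absurd (h ▸ hmatched hj hy) (hQ hx).2.2.2
  · rfl

theorem IsMatching.target_ne (hP : IsMatching γ A B P) (hQ : Q ⊆ augmenting γ A B P w k)
    {q : ι} {x y : α} (hx : x ∈ P q) (hxQ : ∀ i ≤ k, x ∉ walkElt γ w i • Q) (hy : y ∈ Q) {i : ℕ}
    (hi : i ≤ k) : γ q • x ≠ γ (w i).1 • walkElt γ w i • y := by
  intro h
  rcases hi.lt_or_eq with hi | rfl
  · rw [← smul_walkElt_succ] at h
    have he := (hP.eq_of_smul_eq hx ((hQ hy).2.1 i hi) h).2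
    exact hxQ (i + 1) hi (he ▸ smul_mem_smul_set hy)
  · exact (hQ hy).2.2.2 (h ▸ mem_iUnion.2 ⟨q, smul_mem_smul_set hx⟩)

variable {μ : Measure α}

theorem IsMatching.flip [MeasurableConstSMul G α] (hP : IsMatching γ A B P)
    (hQm : MeasurableSet Q) (hQ : Q ⊆ augmenting γ A B P w k)
    (hdisj : ∀ i ≤ k, ∀ j ≤ k, i ≠ j → Disjoint (walkElt γ w i • Q) (walkElt γ w j • Q)) :
    IsMatching γ A B (flipAlong γ P w k Q) := by
  classical
  refine ⟨fun q => ?_, fun p q hpq => ?_, fun q x hx => ?_, fun p q hpq => ?_, fun q => ?_⟩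
  · exact ((hP.measurableSet q).diff (Finset.measurableSet_biUnion _ fun i _ =>
      hQm.const_smul _)).union (Finset.measurableSet_biUnion _ fun i _ => hQm.const_smul _)
  · refine Set.disjoint_left.2 fun x hx hy => ?_
    rcases mem_flipAlong.1 hx with ⟨hx, hx'⟩ | ⟨i, hi, hip, hx⟩ <;>
      rcases mem_flipAlong.1 hy with ⟨hy, hy'⟩ | ⟨j, hj, hjq, hy⟩
    · exact Set.disjoint_left.1 (hP.disjoint p q hpq) hx hy
    · exact hx' j hj hy
    · exact hy' i hi hx
    · refine Set.disjoint_left.1 (hdisj i hi j hj ?_) hx hy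
      rintro rfl
      exact hpq (hip.symm.trans hjq)
  · rcases mem_flipAlong.1 hx with ⟨hx, -⟩ | ⟨i, hi, -, hx⟩
    · exact hP.subset q hx
    · rcases i with _ | i
      · rw [walkElt, one_smul] at hx
        exact (hQ hx).1.1
      · exact hP.subset _ (walkElt_smul_subset hQ hi hx)
  · refine Set.disjoint_left.2 ?_
    rintro _ ⟨x, hx, rfl⟩ ⟨y, hy, hxy⟩
    change γ q • y = γ p • x at hxy
    rcases mem_flipAlong.1 hx with ⟨hx, hx'⟩ | ⟨i, hi, rfl, z, hz, rfl⟩ <;>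
      rcases mem_flipAlong.1 hy with ⟨hy, hy'⟩ | ⟨j, hj, rfl, t, ht, rfl⟩
    · exact hpq (hP.eq_of_smul_eq hy hx hxy).1.symm
    · exact hP.target_ne hQ hx hx' ht hj hxy.symm
    · exact hP.target_ne hQ hy hy' hz hi hxy
    · have := hP.eq_of_target_eq hQ hdisj hj hi ht hz hxy
      exact hpq (by rw [this])
  · rintro _ ⟨x, hx, rfl⟩
    rcases mem_flipAlong.1 hx with ⟨hx, -⟩ | ⟨i, hi, rfl, z, hz, rfl⟩
    · exact hP.smul_subset q (smul_mem_smul_set hx)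
    · change γ (w i).1 • walkElt γ w i • z ∈ B
      rcases hi.lt_or_eq with hi | rfl
      · rw [← smul_walkElt_succ]
        exact hP.smul_subset _ (smul_mem_smul_set ((hQ hz).2.1 i hi))
      · exact (hQ hz).2.2.1

theorem defect_flipAlong (hQm : MeasurableSet Q) (hQ : Q ⊆ augmenting γ A B P w k)
    (hA : μ A ≠ ⊤) : defect μ A (flipAlong γ P w k Q) = defect μ A P - μ.real Q := by
  have h : A \ ⋃ q, flipAlong γ P w k Q q = (A \ ⋃ q, P q) \ Q := by
    ext x
    simp only [mem_sdiff, mem_iUnion, mem_flipAlong, not_exists, and_assoc]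
    refine and_congr_right fun _ => ⟨fun h => ⟨fun q hq => ?_, fun hx => ?_⟩, fun h q hq => ?_⟩
    · by_cases hex : ∃ i ≤ k, x ∈ walkElt γ w i • Q
      · obtain ⟨i, hi, hx⟩ := hex
        exact h (w i).1 (Or.inr ⟨i, hi, rfl, hx⟩)
      · push Not at hex
        exact h q (Or.inl ⟨hq, hex⟩)
    · exact h (w 0).1 (Or.inr ⟨0, Nat.zero_le _, rfl, by rwa [walkElt, one_smul]⟩)
    · rcases hq with ⟨hq, -⟩ | ⟨i, hi, -, hx⟩
      · exact h.1 q hq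
      · rcases i with _ | i
        · exact h.2 (by rwa [walkElt, one_smul] at hx)
        · exact h.1 _ (walkElt_smul_subset hQ hi hx)
  rw [defect, h, measureReal_sdiff (fun x hx => (hQ hx).1) hQm
    (ne_top_of_le_ne_top hA (measure_mono sdiff_subset))]
  rfl

variable [Fintype ι]

theorem familyDist_flipAlong_le [MeasurableConstSMul G α] [SMulInvariantMeasure G α μ]
    (hP : IsMatching γ A B P) (hQm : MeasurableSet Q) :
    familyDist μ P (flipAlong γ P w k Q) ≤ 2 * ((k + 1 : ℕ) * μ Q) := by
  classical
  set F := ⋃ i ∈ Finset.range (k + 1), walkElt γ w i • Q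
  have hF : MeasurableSet F := Finset.measurableSet_biUnion _ fun i _ => hQm.const_smul _
  have hFle : μ F ≤ (k + 1 : ℕ) * μ Q := by
    refine (measure_biUnion_finset_le _ _).trans (le_of_eq ?_)
    simp [measure_smul]
  have h1 : ∑ q, μ (P q ∩ F) ≤ μ F := by
    have h := measure_iUnion (μ := μ) (fun p q hpq => (hP.disjoint p q hpq).mono
      (inter_subset_left (t := F)) (inter_subset_left (t := F)))
      fun q => (hP.measurableSet q).inter hF
    rw [tsum_fintype] at h
    rw [← h]
    exact measure_mono (iUnion_subset fun q => inter_subset_right)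
  have h2 : ∑ q, μ (⋃ i ∈ (Finset.range (k + 1)).filter (fun i => (w i).1 = q), walkElt γ w i • Q)
      ≤ (k + 1 : ℕ) * μ Q := by
    refine (Finset.sum_le_sum fun q _ => measure_biUnion_finset_le _ _).trans (le_of_eq ?_)
    refine (Finset.sum_fiberwise (Finset.range (k + 1)) (fun i => (w i).1)
      fun i => μ (walkElt γ w i • Q)).trans ?_
    simp [measure_smul]
  calc familyDist μ P (flipAlong γ P w k Q)
      ≤ ∑ q, (μ (P q ∩ F) + μ (⋃ i ∈ (Finset.range (k + 1)).filter (fun i => (w i).1 = q),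
          walkElt γ w i • Q)) := by
        refine Finset.sum_le_sum fun q _ => (measure_mono ?_).trans (measure_union_le _ _)
        rintro x (⟨hx, hx'⟩ | ⟨hx | hx, hx'⟩)
        · refine Or.inl ⟨hx, ?_⟩
          by_contra h
          exact hx' (Or.inl ⟨hx, h⟩)
        · exact absurd hx.1 hx'
        · exact Or.inr hx
    _ ≤ 2 * ((k + 1 : ℕ) * μ Q) := by
        rw [Finset.sum_add_distrib, two_mul]
        exact add_le_add (h1.trans hFle) h2

variable [TopologicalSpace α] [T2Space α] [SecondCountableTopology α] [OpensMeasurableSpace α]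
  [ContinuousConstSMul G α]

/-- A set of positive measure contains a subset of positive measure which is moved to pairwise
disjoint sets by finitely many elements acting without coincidences. -/
theorem exists_subset_disjoint_smul {g : ℕ → G} {k : ℕ} (hQm : MeasurableSet Q) (hQ : μ Q ≠ 0)
    (hne : ∀ x ∈ Q, ∀ i ≤ k, ∀ j ≤ k, i ≠ j → g i • x ≠ g j • x) :
    ∃ Q' ⊆ Q, MeasurableSet Q' ∧ μ Q' ≠ 0 ∧
      ∀ i ≤ k, ∀ j ≤ k, i ≠ j → Disjoint (g i • Q') (g j • Q') := by
  obtain ⟨x, hx, hxpos⟩ := exists_mem_forall_mem_nhdsWithin_pos_measure hQ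
  have hU : ∀ p : Fin (k + 1) × Fin (k + 1), p.1 ≠ p.2 → ∃ U ∈ nhds x,
      Disjoint (g p.1 • U) (g p.2 • U) := by
    intro p hp
    obtain ⟨V, hV, W, hW, hVW⟩ := Filter.disjoint_iff.1 (disjoint_nhds_nhds.2
      (hne x hx p.1 (by omega) p.2 (by omega) fun h => hp (Fin.ext h)))
    refine ⟨(g p.1 • ·) ⁻¹' V ∩ (g p.2 • ·) ⁻¹' W, Filter.inter_mem
      ((continuous_const_smul _).continuousAt hV) ((continuous_const_smul _).continuousAt hW),
      hVW.mono ?_ ?_⟩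
    · rintro _ ⟨y, hy, rfl⟩
      exact hy.1
    · rintro _ ⟨y, hy, rfl⟩
      exact hy.2
  choose! U hU hUd using hU
  have hmem : (⋂ p : Fin (k + 1) × Fin (k + 1), ⋂ _ : p.1 ≠ p.2, U p) ∈ nhds x :=
    Filter.iInter_mem.2 fun p => Filter.iInter_mem.2 fun hp => hU p hp
  obtain ⟨O, hO, hOopen, hxO⟩ := mem_nhds_iff.1 hmem
  refine ⟨Q ∩ O, inter_subset_left, hQm.inter hOopen.measurableSet, ?_, fun i hi j hj hij => ?_⟩
  · exact (hxpos _ (inter_mem_nhdsWithin Q (hOopen.mem_nhds hxO))).ne'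
  · let p : Fin (k + 1) × Fin (k + 1) := (⟨i, by omega⟩, ⟨j, by omega⟩)
    have hp : p.1 ≠ p.2 := fun h => hij (congrArg Fin.val h)
    have hsub : Q ∩ O ⊆ U p := fun y hy => mem_iInter.1 (mem_iInter.1 (hO hy.2) p) hp
    exact (hUd p hp).mono (smul_set_mono hsub) (smul_set_mono hsub)

/-- Expansion in both directions allows to improve any matching with positive defect. -/
theorem IsMatching.exists_improvement [MeasurableConstSMul G α] [SMulInvariantMeasure G α μ]
    [Nonempty ι] (hP : IsMatching γ A B P) (hA : MeasurableSet A)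
    (hB : MeasurableSet B) (hfin : μ A ≠ ⊤) (hμ : μ A = μ B)
    (hAB : ∀ X ⊆ A, MeasurableSet X → 2 * μ X ≤ μ (neighbours γ B X) ∨
      3 * μ (B \ neighbours γ B X) ≤ μ B)
    (hBA : ∀ Y ⊆ B, MeasurableSet Y → 2 * μ Y ≤ μ (neighbours (fun i => (γ i)⁻¹) A Y) ∨
      3 * μ (A \ neighbours (fun i => (γ i)⁻¹) A Y) ≤ μ A) (hpos : 0 < defect μ A P) :
    ∃ Q, IsMatching γ A B Q ∧ defect μ A Q < defect μ A P ∧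
      familyDist μ P Q ≤ ENNReal.ofReal
        (4 * √(32 * μ.real A) * (√(defect μ A P) - √(defect μ A Q))) := by
  have hex : ∃ k, ∃ w, μ (augmenting γ A B P w k) ≠ 0 := by
    by_contra! hcon
    obtain ⟨k, hk⟩ := exists_nat_gt (32 * μ.real A / defect μ A P)
    have h1 := hP.sq_mul_defect_le hA hB hfin hμ hAB hBA (k := k) fun l _ => hcon l
    rw [div_lt_iff₀ hpos] at hk
    have h2 : (k : ℝ) * defect μ A P ≤ ((k : ℝ) + 1) ^ 2 * defect μ A P := by
      gcongr
      nlinarith [(Nat.cast_nonneg k : (0 : ℝ) ≤ k)]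
    linarith
  classical
  set k := Nat.find hex
  obtain ⟨w, hw⟩ : ∃ w, μ (augmenting γ A B P w k) ≠ 0 := Nat.find_spec hex
  have hmin : ∀ l < k, ∀ w, μ (augmenting γ A B P w l) = 0 := fun l hl w => by
    by_contra h
    exact Nat.find_min hex hl ⟨w, h⟩
  have hlen := hP.sq_mul_defect_le hA hB hfin hμ hAB hBA hmin
  set N := ⋃ i, ⋃ d, ⋃ _ : 0 < d ∧ i + d ≤ k,
    augmenting γ A B P (fun l => if l < i then w l else w (l + d)) (k - d)
  have hN : μ N = 0 := by
    simp only [N, measure_iUnion_null_iff]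
    exact fun i d h => hmin _ (by omega) _
  have hNm : MeasurableSet N := .iUnion fun i => .iUnion fun d => .iUnion fun _ =>
    hP.measurableSet_augmenting hA hB _ _
  have hlt : ∀ x ∈ augmenting γ A B P w k \ N, ∀ i j, j ≤ k → i < j →
      walkElt γ w i • x ≠ walkElt γ w j • x := by
    intro x hx i j hj hij he
    obtain ⟨d, rfl⟩ := Nat.exists_eq_add_of_lt hij
    exact hx.2 (mem_iUnion.2 ⟨i, mem_iUnion.2 ⟨d + 1, mem_iUnion.2 ⟨by omega,
      mem_augmenting_shortcut (by omega) hx.1 he⟩⟩⟩)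
  obtain ⟨Q, hQsub, hQm, hQ0, hQd⟩ := exists_subset_disjoint_smul (g := walkElt γ w) (k := k)
    ((hP.measurableSet_augmenting hA hB w k).diff hNm) (by rwa [measure_sdiff_null hN])
    fun x hx i hi j hj hij => by
      rcases hij.lt_or_gt with h | h
      · exact hlt x hx i j hj h
      · exact (hlt x hx j i hi h).symm
  replace hQsub := hQsub.trans sdiff_subset
  have hQfin : μ Q ≠ ⊤ := ne_top_of_le_ne_top hfin (measure_mono fun x hx => (hQsub hx).1.1)
  have hQpos : 0 < μ.real Q := ENNReal.toReal_pos hQ0 hQfin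
  have hdef := defect_flipAlong (μ := μ) hQm hQsub hfin
  refine ⟨_, hP.flip hQm hQsub hQd, by linarith, (familyDist_flipAlong_le hP hQm).trans ?_⟩
  have hu' := defect_nonneg μ A (flipAlong γ P w k Q)
  set u := defect μ A P
  set u' := defect μ A (flipAlong γ P w k Q)
  have hQle : μ.real Q ≤ 2 * √u * (√u - √u') := by
    have h1 := Real.sq_sqrt hpos.le
    have h2 := Real.sq_sqrt hu'
    nlinarith [sq_nonneg (√u - √u')]
  have hk : ((k : ℝ) + 1) * √u ≤ √(32 * μ.real A) := by
    refine Real.le_sqrt_of_sq_le ?_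
    rw [mul_pow, Real.sq_sqrt hpos.le]
    exact hlen
  have hsub : 0 ≤ √u - √u' := sub_nonneg.2 (Real.sqrt_le_sqrt (by linarith))
  have hreal : 2 * (((k + 1 : ℕ) : ℝ) * μ.real Q) ≤ 4 * √(32 * μ.real A) * (√u - √u') := by
    push_cast
    calc 2 * (((k : ℝ) + 1) * μ.real Q)
        ≤ 2 * (((k : ℝ) + 1) * (2 * √u * (√u - √u'))) := by gcongr
      _ = 4 * (((k : ℝ) + 1) * √u) * (√u - √u') := by ring
      _ ≤ _ := by gcongr
  refine le_trans (le_of_eq ?_) (ENNReal.ofReal_le_ofReal hreal)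
  rw [ENNReal.ofReal_mul (by norm_num), ENNReal.ofReal_mul (by positivity),
    ofReal_measureReal hQfin, ENNReal.ofReal_natCast, ENNReal.ofReal_ofNat]

end Flip

section Assembly

variable {n : ℕ}

/-- A null-measurable set has a measurable subset of full measure that contains its interior. -/
theorem exists_measurable_subset_interior_subset {α : Type*} [TopologicalSpace α]
    [MeasurableSpace α] [OpensMeasurableSpace α] {μ : Measure α} {A : Set α}
    (hA : NullMeasurableSet A μ) :
    ∃ A' ⊆ A, MeasurableSet A' ∧ interior A ⊆ A' ∧ μ (A \ A') = 0 := by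
  obtain ⟨t, ht, htm, hte⟩ := hA.exists_measurable_subset_ae_eq
  refine ⟨t ∪ interior A, union_subset ht interior_subset, htm.union isOpen_interior.measurableSet,
    subset_union_right, measure_mono_null (sdiff_subset_sdiff_right subset_union_left) ?_⟩
  exact (ae_le_set.1 hte.symm.le)

theorem exists_isMatching_defect_eq_zero_of_isBounded (hn : 3 ≤ n) {A B : Set (EucSp n)}
    (hAm : MeasurableSet A) (hBm : MeasurableSet B)
    (hAb : Bornology.IsBounded A) (hBb : Bornology.IsBounded B)
    (hAi : (interior A).Nonempty) (hBi : (interior B).Nonempty) (hvol : volume A = volume B) :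
    ∃ (S : Finset (EucSp n ≃ᵢ EucSp n)) (P : S → Set (EucSp n)),
      IsMatching (fun s : S => (s : EucSp n ≃ᵢ EucSp n)) A B P ∧ defect volume A P = 0 := by
  classical
  obtain ⟨S₁, h₁⟩ := exists_finset_double_or_cover hn hAb hBb hBi
  obtain ⟨S₂, h₂⟩ := exists_finset_double_or_cover hn hBb hAb hAi
  let S : Finset (EucSp n ≃ᵢ EucSp n) := insert 1 (S₁ ∪ S₂.image (·⁻¹))
  let γ : S → (EucSp n ≃ᵢ EucSp n) := fun s => s
  have : Nonempty S := ⟨⟨1, Finset.mem_insert_self _ _⟩⟩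
  have hAB : ∀ X ⊆ A, MeasurableSet X → 2 * volume X ≤ volume (neighbours γ B X) ∨
      3 * volume (B \ neighbours γ B X) ≤ volume B := by
    intro X hX hXm
    have hsub : (S₁ : Set (EucSp n ≃ᵢ EucSp n)) • X ∩ B ⊆ neighbours γ B X := by
      rintro _ ⟨⟨s, hs, x, hx, rfl⟩, hb⟩
      exact mem_iUnion.2 ⟨⟨s, by simp [S, Finset.mem_coe.1 hs]⟩, smul_mem_smul_set hx, hb⟩
    refine (h₁ X hX hXm).imp (fun h => h.trans (measure_mono hsub)) fun h => le_trans ?_ h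
    gcongr 3 * volume ?_
    exact fun b hb => ⟨hb.1, fun hs => hb.2 (hsub ⟨hs, hb.1⟩)⟩
  have hBA : ∀ Y ⊆ B, MeasurableSet Y →
      2 * volume Y ≤ volume (neighbours (fun i => (γ i)⁻¹) A Y) ∨
        3 * volume (A \ neighbours (fun i => (γ i)⁻¹) A Y) ≤ volume A := by
    intro X hX hXm
    have hsub : (S₂ : Set (EucSp n ≃ᵢ EucSp n)) • X ∩ A ⊆
        neighbours (fun i => (γ i)⁻¹) A X := by
      rintro _ ⟨⟨s, hs, x, hx, rfl⟩, hb⟩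
      refine mem_iUnion.2 ⟨⟨s⁻¹, by simp [S, Finset.mem_coe.1 hs]⟩, ?_, hb⟩
      simpa [γ] using smul_mem_smul_set (a := s) hx
    refine (h₂ X hX hXm).imp (fun h => h.trans (measure_mono hsub)) fun h => le_trans ?_ h
    gcongr 3 * volume ?_
    exact fun b hb => ⟨hb.1, fun hs => hb.2 (hsub ⟨hs, hb.1⟩)⟩
  have hfin : volume A ≠ ⊤ := hAb.measure_lt_top.ne
  exact ⟨S, exists_isMatching_defect_eq_zero (γ := γ) hfin (4 * √(32 * volume.real A))
    (by positivity) fun P hP hpos => hP.exists_improvement hAm hBm hfin hvol hAB hBA hpos⟩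

/-- A matching with zero defect between sets of equal finite measure covers almost all of the
target. -/
theorem IsMatching.measure_diff_eq_zero {G α ι : Type*} [Group G] [MulAction G α]
    [MeasurableSpace α] [Countable ι] [MeasurableConstSMul G α] {μ : Measure α}
    [SMulInvariantMeasure G α μ] {γ : ι → G} {A B : Set α} {P : ι → Set α}
    (hP : IsMatching γ A B P) (hfin : μ A ≠ ⊤) (hμ : μ A = μ B) (hdef : defect μ A P = 0) :
    μ (A \ ⋃ i, P i) = 0 ∧ μ (B \ ⋃ i, γ i • P i) = 0 := by
  have hA0 : μ (A \ ⋃ i, P i) = 0 :=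
    (measureReal_eq_zero_iff (measure_ne_top_of_subset sdiff_subset hfin)).1 hdef
  refine ⟨hA0, ?_⟩
  have hm : MeasurableSet (⋃ i, γ i • P i) :=
    MeasurableSet.iUnion fun i => (hP.measurableSet i).const_smul (γ i)
  have hsub : (⋃ i, γ i • P i) ⊆ B := iUnion_subset hP.smul_subset
  have e : μ (⋃ i, γ i • P i) = μ (⋃ i, P i) := by
    rw [measure_iUnion (fun i j => hP.disjoint_smul i j)
      fun i => (hP.measurableSet i).const_smul (γ i),
      measure_iUnion (fun i j => hP.disjoint i j) hP.measurableSet]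
    simp only [measure_smul]
  have hle : μ A ≤ μ (⋃ i, P i) := measure_mono_ae (ae_le_set.2 hA0)
  rw [measure_sdiff hsub hm.nullMeasurableSet (measure_ne_top_of_subset hsub (hμ ▸ hfin)), e, ← hμ]
  exact tsub_eq_zero_of_le hle

/-- A null set is contained in a null set invariant under finitely many given elements. -/
theorem exists_null_superset_smul_mem_iff {G α : Type*} [Group G] [MulAction G α]
    [MeasurableSpace α] [MeasurableConstSMul G α] {μ : Measure α} [SMulInvariantMeasure G α μ]
    (F : Finset G) {N : Set α} (hN : μ N = 0) :
    ∃ M, N ⊆ M ∧ μ M = 0 ∧ ∀ g ∈ F, ∀ x, g • x ∈ M ↔ x ∈ M := by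
  let f : FreeGroup F →* G := FreeGroup.lift (↑)
  refine ⟨⋃ w, f w • N, fun x hx => mem_iUnion.2 ⟨1, by simpa using hx⟩,
    measure_iUnion_null fun w => by rw [measure_smul, hN], fun g hg x => ?_⟩
  have hgf : f (.of ⟨g, hg⟩) = g := FreeGroup.lift_apply_of
  simp only [mem_iUnion, mem_smul_set_iff_inv_smul_mem]
  constructor
  · rintro ⟨k, hk⟩
    exact ⟨(.of ⟨g, hg⟩)⁻¹ * k, by simpa [hgf, mul_smul] using hk⟩
  · rintro ⟨k, hk⟩
    exact ⟨.of ⟨g, hg⟩ * k, by simpa [hgf, mul_smul] using hk⟩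

theorem MeasurablyEquidecomposable.of_fintype {κ : Type*} [Fintype κ] {A B : Set (EucSp n)}
    (γ : κ → (EucSp n ≃ᵢ EucSp n)) (P : κ → Set (EucSp n))
    (hm : ∀ i, NullMeasurableSet (P i) volume) (hd : ∀ i j, i ≠ j → Disjoint (P i) (P j))
    (hA : ⋃ i, P i = A) (hd' : ∀ i j, i ≠ j → Disjoint (γ i '' P i) (γ j '' P j))
    (hB : ⋃ i, γ i '' P i = B) : MeasurablyEquidecomposable n A B := by
  let e := (Fintype.equivFin κ).symm
  refine ⟨Fintype.card κ, γ ∘ e, P ∘ e, fun i => hm _, fun i j h => hd _ _ (e.injective.ne h), ?_,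
    fun i j h => hd' _ _ (e.injective.ne h), ?_⟩
  · rw [← hA]
    exact e.surjective.iUnion_comp P
  · rw [← hB]
    exact e.surjective.iUnion_comp fun i => γ i '' P i

/-- A matching covering almost everything and a set-theoretic equidecomposition combine into
a measurable equidecomposition. -/
theorem MeasurablyEquidecomposable.of_matching_of_bijective {ι : Type*} [Fintype ι]
    {A B : Set (EucSp n)} {γ : ι → (EucSp n ≃ᵢ EucSp n)} {P : ι → Set (EucSp n)}
    (hP : IsMatching γ A B P) (hA : volume (A \ ⋃ i, P i) = 0)
    (hB : volume (B \ ⋃ i, γ i • P i) = 0) {T : Finset (EucSp n ≃ᵢ EucSp n)} {h : A → B}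
    (hh : Function.Bijective h) (hT : ∀ a : A, ∃ s ∈ T, s • (a : EucSp n) = h a) :
    MeasurablyEquidecomposable n A B := by
  classical
  obtain ⟨N, hNsub, hN, hNinv⟩ := exists_null_superset_smul_mem_iff
    (μ := (volume : Measure (EucSp n))) (Finset.univ.image γ ∪ T) (measure_union_null hA hB)
  have hγ : ∀ i x, γ i • x ∈ N ↔ x ∈ N := fun i x => hNinv _ (by simp) x
  have hTN : ∀ s ∈ T, ∀ x, s • x ∈ N ↔ x ∈ N := fun s hs x => hNinv s (by simp [hs]) x
  choose τ hτ hτh using hT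
  let Q : ι ⊕ T → Set (EucSp n) := Sum.elim (fun i => P i \ N)
    fun s => {x | ∃ hx : x ∈ A, x ∈ N ∧ τ ⟨x, hx⟩ = s}
  let δ : ι ⊕ T → (EucSp n ≃ᵢ EucSp n) := Sum.elim γ (fun s => s)
  have hQN : ∀ i, Q (.inl i) ⊆ Nᶜ := fun i x hx => hx.2
  have hQN' : ∀ s, Q (.inr s) ⊆ N := fun s x hx => hx.2.1
  have hδN : ∀ i, δ (.inl i) '' Q (.inl i) ⊆ Nᶜ := by
    rintro i _ ⟨x, hx, rfl⟩ hx'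
    exact hx.2 ((hγ i x).1 hx')
  have hδN' : ∀ s, δ (.inr s) '' Q (.inr s) ⊆ N := by
    rintro s _ ⟨x, hx, rfl⟩
    exact (hTN s s.2 x).2 hx.2.1
  have hmoved : ∀ (s : T) (x : EucSp n) (hx : x ∈ A), τ ⟨x, hx⟩ = s →
      (s : EucSp n ≃ᵢ EucSp n) x = h ⟨x, hx⟩ := fun s x hx hs => by
    rw [← hτh, hs, isometryEquiv_smul_def]
  refine .of_fintype δ Q ?_ ?_ ?_ ?_ ?_
  · rintro (i | s)
    · exact (hP.measurableSet i).nullMeasurableSet.diff (.of_null hN)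
    · exact .of_null (measure_mono_null (hQN' s) hN)
  · rintro (i | s) (j | t) hij
    · exact (hP.disjoint i j (by simpa using hij)).mono sdiff_subset sdiff_subset
    · exact disjoint_compl_left.mono (hQN i) (hQN' t)
    · exact disjoint_compl_right.mono (hQN' s) (hQN j)
    · rw [Set.disjoint_left]
      rintro x ⟨_, _, h₁⟩ ⟨_, _, h₂⟩
      exact hij (congrArg Sum.inr (Subtype.ext (h₁.symm.trans h₂)))
  · refine subset_antisymm (iUnion_subset ?_) fun x hx => ?_
    · rintro (i | s)
      · exact sdiff_subset.trans (hP.subset i)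
      · exact fun x hx => hx.1
    · by_cases hxN : x ∈ N
      · exact mem_iUnion.2 ⟨.inr ⟨τ ⟨x, hx⟩, hτ _⟩, hx, hxN, rfl⟩
      · have : x ∈ ⋃ i, P i := by
          by_contra hcon
          exact hxN (hNsub (.inl ⟨hx, hcon⟩))
        obtain ⟨i, hi⟩ := mem_iUnion.1 this
        exact mem_iUnion.2 ⟨.inl i, hi, hxN⟩
  · rintro (i | s) (j | t) hij
    · exact (hP.disjoint_smul i j (by simpa using hij)).mono (image_mono sdiff_subset)
        (image_mono sdiff_subset)
    · exact disjoint_compl_left.mono (hδN i) (hδN' t)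
    · exact disjoint_compl_right.mono (hδN' s) (hδN j)
    · rw [Set.disjoint_left]
      rintro _ ⟨x, ⟨hx, _, h₁⟩, rfl⟩ ⟨y, ⟨hy, _, h₂⟩, hxy⟩
      have e : (⟨y, hy⟩ : A) = ⟨x, hx⟩ := hh.1 <| Subtype.ext <| by
        rw [← hmoved t y hy h₂, ← hmoved s x hx h₁]
        exact hxy
      rw [e] at h₂
      exact hij (congrArg Sum.inr (Subtype.ext (h₁.symm.trans h₂)))
  · refine subset_antisymm (iUnion_subset ?_) fun y hy => ?_
    · rintro (i | s)
      · exact (image_mono sdiff_subset).trans (hP.smul_subset i)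
      · rintro _ ⟨x, ⟨hx, _, hs⟩, rfl⟩
        exact (hmoved s x hx hs).symm ▸ (h ⟨x, hx⟩).2
    · by_cases hyN : y ∈ N
      · obtain ⟨⟨x, hx⟩, hxy⟩ := hh.2 ⟨y, hy⟩
        have e : τ ⟨x, hx⟩ • x = y := by rw [hτh, hxy]
        refine mem_iUnion.2 ⟨.inr ⟨τ ⟨x, hx⟩, hτ _⟩, x, ⟨hx, ?_, rfl⟩, e⟩
        rwa [← hTN _ (hτ ⟨x, hx⟩), e]
      · have : y ∈ ⋃ i, γ i • P i := by
          by_contra hcon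
          exact hyN (hNsub (.inr ⟨hy, hcon⟩))
        obtain ⟨i, x, hx, rfl⟩ := mem_iUnion.1 this
        exact mem_iUnion.2 ⟨.inl i, x, ⟨hx, fun hxN => hyN ((hγ i x).2 hxN)⟩, rfl⟩

theorem IsMatching.mono {G α ι : Type*} [Group G] [MulAction G α] [MeasurableSpace α] {γ : ι → G}
    {A B A' B' : Set α} {P : ι → Set α} (hP : IsMatching γ A B P) (hA : A ⊆ A') (hB : B ⊆ B') :
    IsMatching γ A' B' P :=
  ⟨hP.measurableSet, hP.disjoint, fun i => (hP.subset i).trans hA, hP.disjoint_smul,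
    fun i => (hP.smul_subset i).trans hB⟩

end Assembly

end Equidecomposition

/-- Let `n ≥ 3` and let `A, B ⊆ ℝⁿ` be two bounded Lebesgue measurable sets with non-empty
interiors and of the same Lebesgue measure. Then `A` and `B` are equidecomposable using
Lebesgue measurable pieces. -/
theorem measurable_equidecomposition_euclidean (n : ℕ) (hn : 3 ≤ n) (A B : Set (EucSp n))
    (hAm : NullMeasurableSet A volume) (hBm : NullMeasurableSet B volume)
    (hAb : Bornology.IsBounded A) (hBb : Bornology.IsBounded B)
    (hAi : (interior A).Nonempty) (hBi : (interior B).Nonempty)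
    (hvol : volume A = volume B) :
    MeasurablyEquidecomposable n A B := by
  obtain ⟨A', hA', hAm', hAi', hA0⟩ := exists_measurable_subset_interior_subset hAm
  obtain ⟨B', hB', hBm', hBi', hB0⟩ := exists_measurable_subset_interior_subset hBm
  have hvolA : volume A' = volume A :=
    le_antisymm (measure_mono hA') (measure_mono_ae (ae_le_set.2 hA0))
  have hvolB : volume B' = volume B :=
    le_antisymm (measure_mono hB') (measure_mono_ae (ae_le_set.2 hB0))
  have hvol' : volume A' = volume B' := by rw [hvolA, hvolB, hvol]
  obtain ⟨S, P, hP, hdef⟩ := exists_isMatching_defect_eq_zero_of_isBounded hn hAm' hBm'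
    (hAb.subset hA') (hBb.subset hB') (hAi.mono (interior_maximal hAi' isOpen_interior))
    (hBi.mono (interior_maximal hBi' isOpen_interior)) hvol'
  obtain ⟨hP0, hP1⟩ := hP.measure_diff_eq_zero (hAb.subset hA').measure_lt_top.ne hvol' hdef
  obtain ⟨T, h, hh, hT⟩ := exists_finset_bijective hn hAb hBb hAi hBi
  refine .of_matching_of_bijective (hP.mono hA' hB') ?_ ?_ hh hT
  · exact measure_mono_null (sdiff_triangle A A' _) (measure_union_null hA0 hP0)
  · exact measure_mono_null (sdiff_triangle B B' _) (measure_union_null hB0 hP1)
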